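/- Let d ≥ 3. For Haar-almost every g ∈ SL_d(ℝ), the lattice gℤ^d is GFL. -/

import Mathlib

open scoped BigOperators

noncomputable section

/-- `SL_d(ℝ)`. -/
abbrev SLd (d : ℕ) := Matrix.SpecialLinearGroup (Fin d) ℝ

/-- The unimodular lattice `gℤ^d ⊆ ℝ^d`. -/
def latticeOf {d : ℕ} (g : SLd d) : Set (Fin d → ℝ) :=
  Set.range fun m : Fin d → ℤ => (g : Matrix (Fin d) (Fin d) ℝ).mulVec fun i => (m i : ℝ)

/-- A unimodular lattice in `ℝ^d` is a set of the form `gℤ^d` for some `g ∈ SL_d(ℝ)`. -/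
def IsUnimodularLattice {d : ℕ} (x : Set (Fin d → ℝ)) : Prop :=
  ∃ g : SLd d, x = latticeOf g

/-- The grid `x + v`. -/
def grid {d : ℕ} (x : Set (Fin d → ℝ)) (v : Fin d → ℝ) : Set (Fin d → ℝ) :=
  (fun u => u + v) '' x

/-- `N(y) = inf {|∏ i, w i| : w ∈ y}`. -/
def Ngrid {d : ℕ} (y : Set (Fin d → ℝ)) : ℝ :=
  sInf {r : ℝ | ∃ w ∈ y, r = |∏ i, w i|}

/-- The grid `x + v` is L (Littlewood): `inf {|n|·N(x + nv) : n ∈ ℤ, n ≠ 0} = 0`. -/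
def IsL {d : ℕ} (x : Set (Fin d → ℝ)) (v : Fin d → ℝ) : Prop :=
  sInf {r : ℝ | ∃ n : ℤ, n ≠ 0 ∧ r = |(n : ℝ)| * Ngrid (grid x ((n : ℝ) • v))} = 0

/-- The grid `x + v` is FL (L of finite type): `N(x + nv) = 0` for some nonzero integer `n`. -/
def IsFL {d : ℕ} (x : Set (Fin d → ℝ)) (v : Fin d → ℝ) : Prop :=
  ∃ n : ℤ, n ≠ 0 ∧ Ngrid (grid x ((n : ℝ) • v)) = 0

/-- A lattice `x` is GL if every grid `x + v` is L. -/
def IsGL {d : ℕ} (x : Set (Fin d → ℝ)) : Prop := ∀ v : Fin d → ℝ, IsL x v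

/-- A lattice `x` is GFL if every grid `x + v` is FL. -/
def IsGFL {d : ℕ} (x : Set (Fin d → ℝ)) : Prop := ∀ v : Fin d → ℝ, IsFL x v

/-- The topology on `SL_d(ℝ)` induced from the space of matrices. -/
instance (d : ℕ) : TopologicalSpace (SLd d) :=
  TopologicalSpace.induced (fun g : SLd d => (g : Matrix (Fin d) (Fin d) ℝ)) inferInstance

instance (d : ℕ) : MeasurableSpace (SLd d) := borel (SLd d)

namespace FLproof

section torus
variable {ι : Type*} [Fintype ι]

/-- congruence units of a subring of `ℝ^ι` -/
def GU (Λ : Subring (ι → ℝ)) (q : ℕ) : Subgroup (ι → ℝ)ˣ where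
  carrier := {u | (u : ι → ℝ) ∈ Λ ∧ ((u⁻¹ : (ι → ℝ)ˣ) : ι → ℝ) ∈ Λ ∧
    (∃ β ∈ Λ, (u : ι → ℝ) - 1 = (q : ι → ℝ) * β) ∧ |∏ i, (u : ι → ℝ) i| = 1}
  one_mem' := by
    refine ⟨by simp [Λ.one_mem], by simp [Λ.one_mem], ⟨0, Λ.zero_mem, by simp⟩, by simp⟩
  mul_mem' := by
    rintro a b ⟨ha1, ha2, ⟨β, hβ, hab⟩, ha4⟩ ⟨hb1, hb2, ⟨β', hβ', hbb⟩, hb4⟩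
    refine ⟨by simpa using Λ.mul_mem ha1 hb1, by simpa using Λ.mul_mem hb2 ha2,
      ⟨a * β' + β, Λ.add_mem (Λ.mul_mem ha1 hβ') hβ, ?_⟩, ?_⟩
    · push_cast
      linear_combination (a : ι → ℝ) * hbb + hab
    · simp [Finset.prod_mul_distrib, abs_mul, ha4, hb4]
  inv_mem' := by
    rintro a ⟨ha1, ha2, ⟨β, hβ, hab⟩, ha4⟩
    refine ⟨ha2, by simpa using ha1, ⟨-((a⁻¹ : (ι → ℝ)ˣ) : ι → ℝ) * β,
      Λ.mul_mem (Λ.neg_mem ha2) hβ, ?_⟩, ?_⟩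
    · have := a.inv_mul
      linear_combination -((a⁻¹ : (ι → ℝ)ˣ) : ι → ℝ) * hab + this
    · have h := a.inv_mul
      have h2 : |∏ i, ((a⁻¹ : (ι → ℝ)ˣ) : ι → ℝ) i| * |∏ i, (a : ι → ℝ) i| = 1 := by
        rw [← abs_mul, ← Finset.prod_mul_distrib]
        have : ∀ i, ((a⁻¹ : (ι → ℝ)ˣ) : ι → ℝ) i * (a : ι → ℝ) i = 1 := fun i => congrFun h i
        rw [Finset.prod_congr rfl (fun i _ => this i)]; simp
      rwa [ha4, mul_one] at h2

/-- closed periodic invariant sets -/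
def Inv (Λ : Subring (ι → ℝ)) (q : ℕ) (M : Set (ι → ℝ)) : Prop :=
  IsClosed M ∧ M.Nonempty ∧ (∀ x ∈ M, ∀ l ∈ Λ, x + l ∈ M) ∧
    ∀ x ∈ M, ∀ u ∈ GU Λ q, (u : ι → ℝ) * x ∈ M

lemma exists_min (Λ : Subring (ι → ℝ)) (R : ℝ) (hR : ∀ v : ι → ℝ, ∃ l ∈ Λ, ‖v - l‖ ≤ R)
    (q : ℕ) (O : Set (ι → ℝ)) (hO : Inv Λ q O) :
    ∃ M ⊆ O, Minimal (fun M => M ∈ {M | Inv Λ q M}) M := by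
  apply zorn_superset_nonempty {M | Inv Λ q M} ?_ O hO
  intro c hc hchain hne
  refine ⟨⋂₀ c, ⟨isClosed_sInter fun s hs => (hc hs).1, ?_, ?_, ?_⟩, fun s hs => Set.sInter_subset_of_mem hs⟩
  · have key : (⋂₀ ((fun s => s ∩ Metric.closedBall (0 : ι → ℝ) R) '' c)).Nonempty := by
      have : Nonempty ↑((fun s => s ∩ Metric.closedBall (0 : ι → ℝ) R) '' c) :=
        (hne.image _).to_subtype
      apply IsCompact.nonempty_sInter_of_directed_nonempty_isCompact_isClosed
      · rintro _ ⟨s, hs, rfl⟩ _ ⟨t, ht, rfl⟩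
        rcases hchain.total hs ht with h | h
        · exact ⟨_, ⟨s, hs, rfl⟩, subset_rfl, Set.inter_subset_inter_left _ h⟩
        · exact ⟨_, ⟨t, ht, rfl⟩, Set.inter_subset_inter_left _ h, subset_rfl⟩
      · rintro _ ⟨s, hs, rfl⟩
        obtain ⟨x, hx⟩ := (hc hs).2.1
        obtain ⟨l, hl, hxl⟩ := hR x
        refine ⟨x - l, ?_, by simpa using hxl⟩
        have := (hc hs).2.2.1 x hx (-l) (Λ.neg_mem hl)
        simpa [sub_eq_add_neg] using this
      · rintro _ ⟨s, hs, rfl⟩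
        exact (isCompact_closedBall _ _).inter_left (hc hs).1
      · rintro _ ⟨s, hs, rfl⟩
        exact (hc hs).1.inter Metric.isClosed_closedBall
    obtain ⟨x, hx⟩ := key
    exact ⟨x, fun s hs => (hx _ ⟨s, hs, rfl⟩).1⟩
  · intro x hx l hl s hs
    exact (hc hs).2.2.1 x (hx s hs) l hl
  · intro x hx u hu s hs
    exact (hc hs).2.2.2 x (hx s hs) u hu

lemma diff_closed (Λ : Subring (ι → ℝ)) (R : ℝ) (hR : ∀ v : ι → ℝ, ∃ l ∈ Λ, ‖v - l‖ ≤ R)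
    (q : ℕ) (M : Set (ι → ℝ)) (hM : Inv Λ q M) :
    IsClosed {t | ∃ x ∈ M, x + t ∈ M} := by
  apply IsSeqClosed.isClosed
  intro t t0 ht hlim
  choose x hx hxt using ht
  choose l hl hlx using fun n => hR (x n)
  have hmem : ∀ n, x n - l n ∈ Metric.closedBall (0 : ι → ℝ) R := fun n => by simpa using hlx n
  obtain ⟨y, -, φ, hφ, hy⟩ := (isCompact_closedBall (0 : ι → ℝ) R).tendsto_subseq hmem
  have e1 : ∀ n, x n - l n ∈ M := fun n => by
    simpa [sub_eq_add_neg] using hM.2.2.1 _ (hx n) _ (Λ.neg_mem (hl n))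
  have e2 : ∀ n, (x n - l n) + t n ∈ M := fun n => by
    have := hM.2.2.1 _ (hxt n) _ (Λ.neg_mem (hl n))
    convert this using 1
    abel
  refine ⟨y, hM.1.mem_of_tendsto hy (Filter.Eventually.of_forall fun n => e1 _), ?_⟩
  exact hM.1.mem_of_tendsto (hy.add (hlim.comp hφ.tendsto_atTop))
    (Filter.Eventually.of_forall fun n => e2 _)

/-- positive multiplicative density -/
lemma mul_dense (a b : ℝ) (ha : 0 < a) (hb : 0 < b)
    (h : Irrational (Real.log a / Real.log b)) (s : ℝ) (hs : 0 < s) :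
    s ∈ closure {r : ℝ | ∃ x y : ℤ, r = a ^ x * b ^ y} := by
  have hd := dense_addSubgroupClosure_pair_iff.2 h
  have h1 : Real.log s ∈ closure (AddSubgroup.closure {Real.log a, Real.log b} : Set ℝ) := hd _
  have h2 := map_mem_closure Real.continuous_exp h1
    (t := {r : ℝ | ∃ x y : ℤ, r = a ^ x * b ^ y}) ?_
  · rwa [Real.exp_log hs] at h2
  · intro z hz
    obtain ⟨x, y, rfl⟩ := AddSubgroup.mem_closure_pair.1 hz
    refine ⟨x, y, ?_⟩
    rw [Real.exp_add]
    simp only [zsmul_eq_mul]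
    rw [mul_comm (x : ℝ), mul_comm (y : ℝ), Real.exp_mul, Real.exp_mul, Real.exp_log ha,
      Real.exp_log hb, Real.rpow_intCast, Real.rpow_intCast]

lemma small_diff (Λ : Subring (ι → ℝ)) (R : ℝ) (hR : ∀ v : ι → ℝ, ∃ l ∈ Λ, ‖v - l‖ ≤ R)
    (q : ℕ) (M : Set (ι → ℝ)) (hM : Inv Λ q M)
    (htors : ∀ α ∈ Λ, (∀ i, α i ≠ 0) → ∃ n : ℤ, n ≠ 0 ∧ ∃ β ∈ Λ, β * α = (n : ι → ℝ))
    (hno : ∀ p ∈ M, ∀ n : ℤ, n ≠ 0 → (n : ι → ℝ) * p ∉ Λ)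
    (u : (ι → ℝ)ˣ) (hu : u ∈ GU Λ q) (hu1 : ∀ i, |(u : ι → ℝ) i| ≠ 1) (η : ℝ) (hη : 0 < η) :
    ∃ x ∈ M, ∃ w, x + w ∈ M ∧ w ≠ 0 ∧ ‖w‖ < η := by
  obtain ⟨m, hm⟩ := hM.2.1
  have hx : ∀ n : ℕ, (u : ι → ℝ) ^ n * m ∈ M := fun n => by
    have := hM.2.2.2 m hm (u ^ n) (Subgroup.pow_mem _ hu n)
    simpa using this
  choose l hl hlx using fun n : ℕ => hR ((u : ι → ℝ) ^ n * m)
  have hmem : ∀ n, (u : ι → ℝ) ^ n * m - l n ∈ Metric.closedBall (0 : ι → ℝ) R :=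
    fun n => by simpa using hlx n
  obtain ⟨y, -, φ, hφ, hy⟩ := (isCompact_closedBall (0 : ι → ℝ) R).tendsto_subseq hmem
  have hc := hy.cauchySeq
  rw [Metric.cauchySeq_iff'] at hc
  obtain ⟨N, hN⟩ := hc η hη
  have hN1 := hN (N + 1) (by omega)
  have hlt : φ N < φ (N + 1) := hφ (by omega)
  have e1 : ∀ n, (u : ι → ℝ) ^ n * m - l n ∈ M := fun n => by
    simpa [sub_eq_add_neg] using hM.2.2.1 _ (hx n) _ (Λ.neg_mem (hl n))
  refine ⟨_, e1 (φ N), ((u : ι → ℝ) ^ (φ (N+1)) * m - l (φ (N+1))) - ((u : ι → ℝ) ^ (φ N) * m - l (φ N)),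
    ?_, ?_, ?_⟩
  · rw [add_sub_cancel]; exact e1 _
  · intro h0
    obtain ⟨k, hk⟩ := Nat.exists_eq_add_of_lt hlt
    rw [hk] at h0
    -- u^N (u^(k+1) - 1) m ∈ Λ
    have hinv : ((u⁻¹ : (ι → ℝ)ˣ) : ι → ℝ) ∈ Λ := hu.2.1
    have hα : (u : ι → ℝ) ^ (φ N) * ((u : ι → ℝ) ^ (k + 1) - 1) ∈ Λ :=
      Λ.mul_mem (Λ.pow_mem hu.1 _) (Λ.sub_mem (Λ.pow_mem hu.1 _) Λ.one_mem)
    obtain ⟨n, hn, β, hβ, hβn⟩ := htors _ hα (by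
      intro i
      have hui : (u : ι → ℝ) i ≠ 0 := by
        intro h
        have := congrFun u.mul_inv i
        simp [h] at this
      simp only [Pi.mul_apply, Pi.pow_apply, Pi.sub_apply, Pi.one_apply]
      refine mul_ne_zero (pow_ne_zero _ hui) ?_
      intro h
      have h' : (u : ι → ℝ) i ^ (k + 1) = 1 := by linarith
      have := congrArg abs h'
      rw [abs_pow, abs_one] at this
      exact hu1 i ((pow_eq_one_iff_of_nonneg (abs_nonneg _) (by omega)).1 this))
    apply hno m hm n hn
    rw [← hβn, mul_assoc]
    apply Λ.mul_mem hβ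
    have : (u : ι → ℝ) ^ (φ N) * ((u : ι → ℝ) ^ (k + 1) - 1) * m = l (φ N + k + 1) - l (φ N) := by
      rw [add_assoc] at h0 ⊢
      rw [pow_add] at h0
      linear_combination h0
    rw [this]
    exact Λ.sub_mem (hl _) (hl _)
  · rw [← dist_eq_norm]; exact hN1


lemma axis (Λ : Subring (ι → ℝ)) (R : ℝ) (hR : ∀ v : ι → ℝ, ∃ l ∈ Λ, ‖v - l‖ ≤ R)
    (q : ℕ) (M : Set (ι → ℝ)) (hM : Inv Λ q M) [DecidableEq ι] (i : ι)
    (hsm : ∀ η > 0, ∃ x ∈ M, ∃ w, x + w ∈ M ∧ w i ≠ 0 ∧ ‖w‖ < η)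
    (u : (ι → ℝ)ˣ) (hu : u ∈ GU Λ q) (hui : 1 < |(u : ι → ℝ) i|)
    (huj : ∀ j, j ≠ i → |(u : ι → ℝ) j| < 1) :
    ∃ c : ℝ, c ≠ 0 ∧ ∃ x ∈ M, x + Pi.single i c ∈ M := by
  set Δ := {t | ∃ x ∈ M, x + t ∈ M} with hΔ
  have hcl : IsClosed Δ := diff_closed Λ R hR q M hM
  set C := |(u : ι → ℝ) i| with hC
  have key : ∀ n : ℕ, ∃ w ∈ Δ, 1 ≤ |w i| ∧ |w i| ≤ C ∧ ∀ j, j ≠ i → |w j| ≤ 1 / ((n : ℝ) + 1) := by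
    intro n
    obtain ⟨x, hx, w, hxw, hwi, hw⟩ := hsm (1 / ((n : ℝ) + 1)) (by positivity)
    have hwj : ∀ j, |w j| ≤ 1 / ((n : ℝ) + 1) := fun j => (norm_le_pi_norm w j).trans hw.le
    have hw1 : |w i| < 1 := by
      refine ((norm_le_pi_norm w i).trans_lt hw).trans_le ?_
      rw [div_le_one (by positivity)]; linarith [n.cast_nonneg (α := ℝ)]
    have hex : ∃ k : ℕ, 1 ≤ C ^ k * |w i| := by
      obtain ⟨k, hk⟩ := pow_unbounded_of_one_lt (1 / |w i|) hui
      refine ⟨k, ?_⟩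
      rw [div_lt_iff₀ (abs_pos.2 hwi)] at hk
      exact hk.le
    classical
    obtain ⟨k, hk⟩ : ∃ k, k + 1 = Nat.find hex := by
      have : Nat.find hex ≠ 0 := by
        intro h
        have := Nat.find_spec hex
        rw [h] at this
        simp at this
        linarith
      exact ⟨Nat.find hex - 1, by omega⟩
    have h1 := Nat.find_spec hex
    have h2 := Nat.find_min hex (m := k) (by omega)
    rw [← hk] at h1
    refine ⟨(u : ι → ℝ) ^ (k + 1) * w, ⟨(u : ι → ℝ) ^ (k + 1) * x, ?_, ?_⟩, ?_, ?_, ?_⟩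
    · simpa using hM.2.2.2 x hx (u ^ (k + 1)) (Subgroup.pow_mem _ hu _)
    · simpa [mul_add] using hM.2.2.2 _ hxw (u ^ (k + 1)) (Subgroup.pow_mem _ hu _)
    · simpa [abs_mul, abs_pow] using h1
    · simp only [Pi.mul_apply, Pi.pow_apply, abs_mul, abs_pow]
      rw [← hC, pow_succ]
      have : C * (C ^ k * |w i|) ≤ C * 1 := by
        apply mul_le_mul_of_nonneg_left _ (abs_nonneg _)
        linarith
      linarith
    · intro j hj
      simp only [Pi.mul_apply, Pi.pow_apply, abs_mul, abs_pow]
      calc _ ≤ 1 * |w j| := by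
            gcongr
            exact pow_le_one₀ (abs_nonneg _) (huj j hj).le
        _ ≤ _ := by rw [one_mul]; exact hwj j
  choose w hwΔ hw1 hwC hwj using key
  have hb : ∀ n, w n ∈ Metric.closedBall (0 : ι → ℝ) C := by
    intro n
    rw [mem_closedBall_zero_iff, pi_norm_le_iff_of_nonneg (abs_nonneg _)]
    intro j
    by_cases hj : j = i
    · subst hj; exact hwC n
    · refine (hwj n j hj).trans (le_trans ?_ hui.le)
      rw [div_le_one (by positivity)]; linarith [n.cast_nonneg (α := ℝ)]
  obtain ⟨y, -, φ, hφ, hy⟩ := (isCompact_closedBall (0 : ι → ℝ) C).tendsto_subseq hb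
  have hyΔ : y ∈ Δ := hcl.mem_of_tendsto hy (Filter.Eventually.of_forall fun n => hwΔ _)
  have hyi := (tendsto_pi_nhds.1 hy)
  have h1 : 1 ≤ |y i| := ge_of_tendsto' ((hyi i).abs) (fun n => hw1 _)
  have h0 : ∀ j, j ≠ i → y j = 0 := by
    intro j hj
    have ht : Filter.Tendsto (fun n => |w (φ n) j|) Filter.atTop (nhds 0) :=
      squeeze_zero (fun _ => abs_nonneg _) (fun n => hwj (φ n) j hj)
        (tendsto_one_div_add_atTop_nhds_zero_nat.comp hφ.tendsto_atTop)
    have := tendsto_nhds_unique ((hyi j).abs) ht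
    exact abs_eq_zero.1 this
  refine ⟨y i, ?_, ?_⟩
  · intro h; rw [h] at h1; simp at h1; linarith
  · have : Pi.single i (y i) = y := by
      ext j
      by_cases hj : j = i
      · subst hj; simp
      · simp [hj, h0 j hj]
    rw [this]; exact hyΔ

theorem torus_main [Nonempty ι] (Λ : Subring (ι → ℝ)) (R : ℝ)
    (hR : ∀ v : ι → ℝ, ∃ l ∈ Λ, ‖v - l‖ ≤ R)
    (htors : ∀ α ∈ Λ, (∀ i, α i ≠ 0) → ∃ n : ℤ, n ≠ 0 ∧ ∃ β ∈ Λ, β * α = (n : ι → ℝ))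
    (hper : ∀ q : ℕ, 0 < q → ∀ u ∈ GU Λ 1, ∃ K : ℕ, 0 < K ∧ u ^ K ∈ GU Λ q)
    (hdom : ∀ i, ∃ u ∈ GU Λ 1, 1 < |(u : ι → ℝ) i| ∧ ∀ j, j ≠ i → |(u : ι → ℝ) j| < 1)
    (hirr : ∀ i, ∃ a ∈ GU Λ 1, ∃ b ∈ GU Λ 1,
      Irrational (Real.log |(a : ι → ℝ) i| / Real.log |(b : ι → ℝ) i|)) (v : ι → ℝ) :
    ∃ n : ℤ, n ≠ 0 ∧ ∀ η > 0, ∃ l ∈ Λ, |∏ i, ((n : ι → ℝ) * v + l) i| < η := by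
  classical
  set O := closure {z : ι → ℝ | ∃ u ∈ GU Λ 1, ∃ l ∈ Λ, z = u * v + l} with hO
  -- reduction
  suffices hs : ∃ n : ℤ, n ≠ 0 ∧ ∃ p ∈ O, (n : ι → ℝ) * p ∈ Λ by
    obtain ⟨n, hn, p, hp, hnp⟩ := hs
    refine ⟨n, hn, fun η hη => ?_⟩
    have hcont : Continuous fun z : ι → ℝ => |∏ i, ((n : ι → ℝ) * z - (n : ι → ℝ) * p) i| := by
      have : ∀ i, Continuous fun z : ι → ℝ => ((n : ι → ℝ) * z - (n : ι → ℝ) * p) i := fun i => by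
        simp only [Pi.sub_apply, Pi.mul_apply]; fun_prop
      fun_prop
    have h0 : |∏ i, ((n : ι → ℝ) * p - (n : ι → ℝ) * p) i| < η := by
      simpa using hη
    have hopen : IsOpen {z : ι → ℝ | |∏ i, ((n : ι → ℝ) * z - (n : ι → ℝ) * p) i| < η} :=
      isOpen_lt hcont continuous_const
    obtain ⟨z, hz, u, hu, l, hl, rfl⟩ := mem_closure_iff.1 hp _ hopen h0
    refine ⟨(u⁻¹ : (ι → ℝ)ˣ) * ((n : ι → ℝ) * l - n * p), Λ.mul_mem hu.2.1
      (Λ.sub_mem (Λ.mul_mem (intCast_mem Λ n) hl) hnp), ?_⟩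
    refine lt_of_eq_of_lt ?_ hz
    have : (n : ι → ℝ) * (u * v + l) - n * p =
        u * ((n : ι → ℝ) * v + (u⁻¹ : (ι → ℝ)ˣ) * ((n : ι → ℝ) * l - n * p)) := by
      linear_combination -((n : ι → ℝ) * l - n * p) * u.mul_inv
    rw [this]
    simp only [Pi.mul_apply (u : ι → ℝ), Finset.prod_mul_distrib, abs_mul]
    rw [hu.2.2.2, one_mul]
  by_contra hcon
  push Not at hcon
  have hOinv : ∀ q, Inv Λ q O := by
    intro q
    refine ⟨isClosed_closure, ⟨v, subset_closure ⟨1, Subgroup.one_mem _, 0, Λ.zero_mem, by simp⟩⟩,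
      ?_, ?_⟩
    · intro x hx l hl
      refine map_mem_closure (f := fun x => x + l) (by fun_prop) hx ?_
      rintro _ ⟨u, hu, l', hl', rfl⟩
      exact ⟨u, hu, l' + l, Λ.add_mem hl' hl, by ring⟩
    · intro x hx w hw
      refine map_mem_closure (f := fun x => (w : ι → ℝ) * x) (by fun_prop) hx ?_
      rintro _ ⟨u, hu, l', hl', rfl⟩
      refine ⟨w * u, Subgroup.mul_mem _ ⟨hw.1, hw.2.1, ⟨(w : ι → ℝ) - 1,
        Λ.sub_mem hw.1 Λ.one_mem, by simp⟩, hw.2.2.2⟩ hu, w * l', Λ.mul_mem hw.1 hl', ?_⟩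
      push_cast
      ring
  have hclose : ∀ q : ℕ, 0 < q → ∃ x ∈ O, ‖x‖ ≤ R / q := by
    intro q hq
    obtain ⟨M, hMO, hmin⟩ := exists_min Λ R hR q O (hOinv q)
    have hM : Inv Λ q M := hmin.1
    have hno : ∀ p ∈ M, ∀ n : ℤ, n ≠ 0 → (n : ι → ℝ) * p ∉ Λ :=
      fun p hp n hn => hcon n hn p (hMO hp)
    set Δ := {t | ∃ x ∈ M, x + t ∈ M} with hΔ
    have hcl : IsClosed Δ := diff_closed Λ R hR q M hM
    -- a coordinate with small nonzero
    have hsm : ∃ i, ∀ η > 0, ∃ x ∈ M, ∃ w, x + w ∈ M ∧ w i ≠ 0 ∧ ‖w‖ < η := by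
      by_contra hc
      push Not at hc
      choose η hη hbad using hc
      obtain ⟨i0⟩ := ‹Nonempty ι›
      obtain ⟨u, hu, hu1, hu2⟩ := hdom i0
      obtain ⟨K, hK, huK⟩ := hper q hq u hu
      have hne : (Finset.univ : Finset ι).Nonempty := ⟨i0, Finset.mem_univ _⟩
      obtain ⟨x, hx, w, hxw, hw0, hw⟩ := small_diff Λ R hR q M hM htors hno (u ^ K) huK (by
        intro i h
        rw [Units.val_pow_eq_pow_val, Pi.pow_apply, abs_pow,
          pow_eq_one_iff_of_nonneg (abs_nonneg _) hK.ne'] at h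
        by_cases hi : i = i0
        · subst hi; linarith
        · linarith [hu2 i hi]) (Finset.univ.inf' hne η) (by
          rw [Finset.lt_inf'_iff]; intro i _; exact hη i)
      obtain ⟨i, hi⟩ := Function.ne_iff.1 hw0
      have := hbad i x hx w hxw hi
      have h2 := Finset.inf'_le η (Finset.mem_univ i)
      linarith
    obtain ⟨i, hi⟩ := hsm
    obtain ⟨u0, hu0, hui0, huj0⟩ := hdom i
    obtain ⟨K, hK, huK⟩ := hper q hq u0 hu0
    set u := u0 ^ K with hu
    have hui : 1 < |(u : ι → ℝ) i| := by
      rw [hu, Units.val_pow_eq_pow_val, Pi.pow_apply, abs_pow]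
      exact one_lt_pow₀ hui0 hK.ne'
    have huj : ∀ j, j ≠ i → |(u : ι → ℝ) j| < 1 := by
      intro j hj
      rw [hu, Units.val_pow_eq_pow_val, Pi.pow_apply, abs_pow]
      exact pow_lt_one₀ (abs_nonneg _) (huj0 j hj) hK.ne'
    obtain ⟨c, hc0, hcΔ⟩ := axis Λ R hR q M hM i hi u huK hui huj
    have hΔneg : ∀ t ∈ Δ, -t ∈ Δ := by
      rintro t ⟨x, hx, hxt⟩
      exact ⟨x + t, hxt, by simpa using hx⟩
    have hΔu : ∀ t ∈ Δ, ∀ w ∈ GU Λ q, (w : ι → ℝ) * t ∈ Δ := by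
      rintro t ⟨x, hx, hxt⟩ w hw
      refine ⟨w * x, hM.2.2.2 _ hx _ hw, ?_⟩
      rw [← mul_add]; exact hM.2.2.2 _ hxt _ hw
    have hΔl : ∀ t ∈ Δ, ∀ l ∈ Λ, t + l ∈ Δ := by
      rintro t ⟨x, hx, hxt⟩ l hl
      refine ⟨x, hx, ?_⟩
      rw [← add_assoc]; exact hM.2.2.1 _ hxt _ hl
    -- positive multiples
    obtain ⟨a, ha, b, hb, hab⟩ := hirr i
    obtain ⟨Ka, hKa, haK⟩ := hper q hq a ha
    obtain ⟨Kb, hKb, hbK⟩ := hper q hq b hb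
    have hnz : ∀ w : (ι → ℝ)ˣ, (w : ι → ℝ) i ≠ 0 := by
      intro w h
      have := congrFun w.mul_inv i
      simp [h] at this
    have hpos : ∀ s : ℝ, 0 < s → Pi.single i (s * c) ∈ Δ := by
      intro s hs
      have hmd := mul_dense ((((a ^ Ka) ^ 2 : (ι → ℝ)ˣ) : ι → ℝ) i) ((((b ^ Kb) ^ 2 : (ι → ℝ)ˣ) : ι → ℝ) i)
        (by have := hnz (a ^ Ka); push_cast at this ⊢; simp only [Pi.pow_apply] at this ⊢; positivity)
        (by have := hnz (b ^ Kb); push_cast at this ⊢; simp only [Pi.pow_apply] at this ⊢; positivity)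
        (by
          push_cast
          simp only [Pi.pow_apply, Real.log_pow]
          rw [← Real.log_abs ((a : ι → ℝ) i), ← Real.log_abs ((b : ι → ℝ) i)]
          have e : ((2 : ℕ) : ℝ) * (Ka * Real.log |(a : ι → ℝ) i|) / ((2 : ℕ) * (Kb * Real.log |(b : ι → ℝ) i|))
            = ((Ka / Kb : ℚ) : ℝ) * (Real.log |(a : ι → ℝ) i| / Real.log |(b : ι → ℝ) i|) := by
            push_cast
            rw [mul_div_mul_left _ _ (by norm_num), mul_div_mul_comm]
          rw [e]
          apply hab.ratCast_mul
          positivity) s hs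
      have := map_mem_closure (f := fun s : ℝ => (Pi.single i (s * c) : ι → ℝ)) (t := Δ)
        ((continuous_single i).comp (by fun_prop)) hmd ?_
      · rwa [hcl.closure_eq] at this
      · rintro r ⟨x, y, rfl⟩
        have := hΔu _ hcΔ (((a ^ Ka) ^ 2) ^ x * ((b ^ Kb) ^ 2) ^ y) (Subgroup.mul_mem _
          (Subgroup.zpow_mem _ (Subgroup.pow_mem _ haK _) _)
          (Subgroup.zpow_mem _ (Subgroup.pow_mem _ hbK _) _))
        convert this using 1
        have hz : ∀ (w : (ι → ℝ)ˣ) (x : ℤ), ((w ^ x : (ι → ℝ)ˣ) : ι → ℝ) i = ((w : ι → ℝ) i) ^ x := by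
          intro w x
          have := congrArg Units.val (map_zpow (Units.map (Pi.evalMonoidHom (fun _ : ι => ℝ) i)) w x)
          rw [Units.val_zpow_eq_zpow_val] at this
          exact this
        ext j
        by_cases hj : j = i
        · subst hj
          simp only [Pi.single_eq_same, Units.val_mul, Pi.mul_apply, hz]
        · simp [hj]
    have hall : ∀ s : ℝ, Pi.single i s ∈ Δ := by
      intro s
      rcases lt_trichotomy (s / c) 0 with h | h | h
      · have := hΔneg _ (hpos (-(s / c)) (by linarith))
        rw [← Pi.single_neg] at this
        have e : -(-(s / c) * c) = s := by
          rw [neg_mul, neg_neg, div_mul_cancel₀ _ hc0]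
        rwa [e] at this
      · have : s = 0 := by
          rcases div_eq_zero_iff.1 h with h | h
          · exact h
          · exact absurd h hc0
        subst this
        obtain ⟨x, hx⟩ := hM.2.1
        exact ⟨x, hx, by simpa using hx⟩
      · have := hpos (s / c) h
        rwa [div_mul_cancel₀ _ hc0] at this
    -- torsion points are in Δ
    have htor : ∀ t : ι → ℝ, (q : ι → ℝ) * t ∈ Λ → t ∈ Δ := by
      intro t ht
      have hut : ∀ k : ℕ, (u : ι → ℝ) ^ k * t - t ∈ Λ := by
        intro k
        obtain ⟨-, -, ⟨β, hβ, hb⟩, -⟩ := Subgroup.pow_mem _ huK k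
        have : (u : ι → ℝ) ^ k * t - t = β * ((q : ι → ℝ) * t) := by
          push_cast at hb
          linear_combination t * hb
        rw [this]; exact Λ.mul_mem hβ ht
      have hmem : ∀ k : ℕ, Pi.single i (((u : ι → ℝ) ^ k * t) i) - ((u : ι → ℝ) ^ k * t - t) ∈ Δ := by
        intro k
        have := hΔl _ (hall (((u : ι → ℝ) ^ k * t) i)) _ (Λ.neg_mem (hut k))
        rwa [← sub_eq_add_neg] at this
      refine hcl.mem_of_tendsto (b := Filter.atTop) ?_ (Filter.Eventually.of_forall hmem)
      rw [tendsto_pi_nhds]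
      intro j
      by_cases hj : j = i
      · subst hj
        simp
      · simp only [Pi.sub_apply, Pi.single_eq_of_ne hj, Pi.mul_apply, Pi.pow_apply]
        have := (tendsto_pow_atTop_nhds_zero_of_abs_lt_one (huj j hj)).mul_const (t j)
        have h2 := (tendsto_const_nhds (x := t j)).sub this
        simp only [zero_mul, sub_zero] at h2
        refine h2.congr fun k => by ring
    -- M invariant under torsion
    have htrans : ∀ t : ι → ℝ, (q : ι → ℝ) * t ∈ Λ → ∀ m ∈ M, m + t ∈ M := by
      intro t ht m hm
      have hinv : Inv Λ q (M ∩ {x | x + t ∈ M}) := by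
        refine ⟨hM.1.inter (hM.1.preimage (by fun_prop)), ?_, ?_, ?_⟩
        · obtain ⟨x, hx, hxt⟩ := htor t ht
          exact ⟨x, hx, hxt⟩
        · rintro x ⟨hx, hxt⟩ l hl
          refine ⟨hM.2.2.1 _ hx _ hl, ?_⟩
          have := hM.2.2.1 _ hxt _ hl
          rwa [add_right_comm] at this
        · rintro x ⟨hx, hxt⟩ w hw
          refine ⟨hM.2.2.2 _ hx _ hw, ?_⟩
          obtain ⟨β, hβ, hb⟩ := hw.2.2.1
          have := hM.2.2.1 _ (hM.2.2.2 _ hxt _ hw) _ (Λ.neg_mem (Λ.mul_mem hβ ht))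
          show _ ∈ M
          convert this using 1
          linear_combination -t * hb
      exact (hmin.2 hinv Set.inter_subset_left hm).2
    obtain ⟨m, hm⟩ := hM.2.1
    obtain ⟨l, hl, hml⟩ := hR ((q : ι → ℝ) * m)
    have hq0 : (q : ℝ) ≠ 0 := by positivity
    refine ⟨m + -((q : ℝ)⁻¹ • l), hMO (htrans _ ?_ m hm), ?_⟩
    · convert Λ.neg_mem hl using 1
      ext j
      simp [hq0]
    · have : m + -((q : ℝ)⁻¹ • l) = (q : ℝ)⁻¹ • ((q : ι → ℝ) * m - l) := by
        ext j
        simp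
        field_simp
        ring
      rw [this, norm_smul, norm_inv, Real.norm_natCast, div_eq_inv_mul]
      gcongr
  -- 0 ∈ O
  apply hcon 1 one_ne_zero 0 _ (by simpa using Λ.zero_mem)
  choose x hx hxn using fun n : ℕ => hclose (n + 1) (Nat.succ_pos n)
  have : Filter.Tendsto x Filter.atTop (nhds 0) := by
    apply squeeze_zero_norm hxn
    have := (tendsto_one_div_add_atTop_nhds_zero_nat (𝕜 := ℝ)).const_mul R
    simpa [div_eq_mul_inv] using this
  exact isClosed_closure.mem_of_tendsto this (Filter.Eventually.of_forall hx)

end torus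
end FLproof

namespace FLproof

lemma exists_theta : ∃ θ : Fin 3 → ℝ, (∀ i, θ i ^ 3 = 3 * θ i - 1) ∧
    (-2 < θ 0 ∧ θ 0 < -1) ∧ (0 < θ 1 ∧ θ 1 < 1/2) ∧ (1 < θ 2 ∧ θ 2 < 8/5) := by
  have hc : Continuous fun x : ℝ => x ^ 3 - 3 * x + 1 := by fun_prop
  obtain ⟨x, hx, hx'⟩ := intermediate_value_Ioo (by norm_num : (-2:ℝ) ≤ -1) hc.continuousOn
    (show (0:ℝ) ∈ _ by norm_num)
  obtain ⟨y, hy, hy'⟩ := intermediate_value_Ioo' (by norm_num : (0:ℝ) ≤ 1/2) hc.continuousOn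
    (show (0:ℝ) ∈ _ by norm_num)
  obtain ⟨z, hz, hz'⟩ := intermediate_value_Ioo (by norm_num : (1:ℝ) ≤ 8/5) hc.continuousOn
    (show (0:ℝ) ∈ _ by norm_num)
  refine ⟨![x, y, z], ?_, hx, hy, hz⟩
  intro i
  simp only at hx' hy' hz'
  fin_cases i <;> simp <;> linarith

/-- The order `ℤ[θ]`. -/
def ZTheta (θ : Fin 3 → ℝ) (h : ∀ i, θ i ^ 3 = 3 * θ i - 1) : Subring (Fin 3 → ℝ) where
  carrier := {x | ∃ a b c : ℤ, ∀ i, x i = a + b * θ i + c * θ i ^ 2}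
  zero_mem' := ⟨0, 0, 0, by simp⟩
  one_mem' := ⟨1, 0, 0, by simp⟩
  add_mem' := by
    rintro x y ⟨a, b, c, hx⟩ ⟨a', b', c', hy⟩
    refine ⟨a + a', b + b', c + c', fun i => ?_⟩
    rw [Pi.add_apply, hx, hy]; push_cast; ring
  neg_mem' := by
    rintro x ⟨a, b, c, hx⟩
    refine ⟨-a, -b, -c, fun i => ?_⟩
    rw [Pi.neg_apply, hx]; push_cast; ring
  mul_mem' := by
    rintro x y ⟨a, b, c, hx⟩ ⟨a', b', c', hy⟩
    refine ⟨a * a' - (b * c' + c * b'), a * b' + b * a' + 3 * (b * c' + c * b') - c * c',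
      a * c' + b * b' + c * a' + 3 * (c * c'), fun i => ?_⟩
    rw [Pi.mul_apply, hx, hy]; push_cast
    have := h i
    linear_combination (b * c' + c * b' + c * c' * θ i : ℝ) * this

lemma mem_ZTheta {θ : Fin 3 → ℝ} {h : ∀ i, θ i ^ 3 = 3 * θ i - 1} {x : Fin 3 → ℝ} :
    x ∈ ZTheta θ h ↔ ∃ a b c : ℤ, ∀ i, x i = a + b * θ i + c * θ i ^ 2 := Iff.rfl

lemma zt_tors_aux (Λ : Subring (Fin 3 → ℝ)) (α : Fin 3 → ℝ) (hα : α ∈ Λ) (h0 : ∀ i, α i ≠ 0)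
    (n : ℕ) : ∀ P : Polynomial ℤ, P ≠ 0 → P.natDegree ≤ n → Polynomial.aeval α P = 0 →
      ∃ n : ℤ, n ≠ 0 ∧ ∃ β ∈ Λ, β * α = (n : Fin 3 → ℝ) := by
  have hcan : ∀ x : Fin 3 → ℝ, x * α = 0 → x = 0 := by
    intro x hx
    ext i
    have := congrFun hx i
    simpa [h0 i] using this
  have hmem : ∀ P : Polynomial ℤ, Polynomial.aeval α P ∈ Λ := by
    intro P
    rw [Polynomial.aeval_eq_sum_range]
    apply Λ.sum_mem
    intro i _
    exact Λ.zsmul_mem (Λ.pow_mem hα i) _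
  induction n with
  | zero =>
    intro P hP hd h
    rw [Polynomial.eq_C_of_natDegree_le_zero hd] at h hP
    have := congrFun h 0
    simp at this
    simp [this] at hP
  | succ n ih =>
    intro P hP hd h
    have e := Polynomial.divX_mul_X_add P
    have h2 : Polynomial.aeval α P.divX * α + (P.coeff 0 : Fin 3 → ℝ) = 0 := by
      rw [← e] at h
      simpa using h
    by_cases hc : P.coeff 0 = 0
    · apply ih P.divX
      · intro h0
        rw [h0, hc] at e
        simp at e
        exact hP e.symm
      · rw [Polynomial.natDegree_divX_eq_natDegree_tsub_one]; omega
      · apply hcan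
        simpa [hc] using h2
    · refine ⟨P.coeff 0, hc, -Polynomial.aeval α P.divX, Λ.neg_mem (hmem _), ?_⟩
      linear_combination -h2

lemma zt_tors (θ : Fin 3 → ℝ) (h : ∀ i, θ i ^ 3 = 3 * θ i - 1) :
    ∀ α ∈ ZTheta θ h, (∀ i, α i ≠ 0) → ∃ n : ℤ, n ≠ 0 ∧ ∃ β ∈ ZTheta θ h, β * α = (n : Fin 3 → ℝ) := by
  intro α hα h0
  have hint : IsIntegral ℤ θ := by
    refine ⟨Polynomial.X ^ 3 - (Polynomial.C 3 * Polynomial.X - Polynomial.C 1), ?_, ?_⟩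
    · apply Polynomial.monic_X_pow_sub
      compute_degree!
    · ext i
      simp [h i]
  have hai : IsIntegral ℤ α := by
    obtain ⟨a, b, c, hx⟩ := hα
    have : α = a + b * θ + c * θ ^ 2 := by
      ext i; simp [hx i]
    rw [this]
    refine ((isIntegral_algebraMap (x := a)).add ((isIntegral_algebraMap (x := b)).mul hint)).add
      ((isIntegral_algebraMap (x := c)).mul (hint.pow 2))
  obtain ⟨P, hP, hP'⟩ := hai
  exact zt_tors_aux _ α hα h0 _ P hP.ne_zero le_rfl hP'

lemma zt_per (θ : Fin 3 → ℝ) (h : ∀ i, θ i ^ 3 = 3 * θ i - 1) :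
    ∀ q : ℕ, 0 < q → ∀ u ∈ GU (ZTheta θ h) 1, ∃ K, 0 < K ∧ u ^ K ∈ GU (ZTheta θ h) q := by
  intro q hq u hu
  have hpow : ∀ n : ℕ, u ^ n ∈ GU (ZTheta θ h) 1 := fun n => Subgroup.pow_mem _ hu n
  choose a b c habc using fun n => mem_ZTheta.1 (hpow n).1
  have : NeZero q := ⟨hq.ne'⟩
  obtain ⟨n, m, hnm, he⟩ := Finite.exists_ne_map_eq_of_infinite
    (fun n : ℕ => ((a n : ZMod q), (b n : ZMod q), (c n : ZMod q)))
  wlog hlt : n < m generalizing n m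
  · exact this m n hnm.symm he.symm (by omega)
  simp only [Prod.mk.injEq] at he
  have hz : ∀ x y : ℤ, (x : ZMod q) = y → ∃ z, y - x = q * z := fun x y hxy =>
    (ZMod.intCast_eq_intCast_iff_dvd_sub x y q).1 hxy
  obtain ⟨za, hza⟩ := hz _ _ he.1
  obtain ⟨zb, hzb⟩ := hz _ _ he.2.1
  obtain ⟨zc, hzc⟩ := hz _ _ he.2.2
  refine ⟨m - n, by omega, (hpow _).1, (hpow _).2.1, ?_, (hpow _).2.2.2⟩
  refine ⟨(fun i => za + zb * θ i + zc * θ i ^ 2) * (((u ^ n)⁻¹ : (Fin 3 → ℝ)ˣ) : Fin 3 → ℝ),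
    (ZTheta θ h).mul_mem ⟨za, zb, zc, fun i => rfl⟩ (hpow n).2.1, ?_⟩
  have e1 : ((u ^ m : (Fin 3 → ℝ)ˣ) : Fin 3 → ℝ) - ((u ^ n : (Fin 3 → ℝ)ˣ) : Fin 3 → ℝ) =
      (q : Fin 3 → ℝ) * (fun i => za + zb * θ i + zc * θ i ^ 2) := by
    ext i
    rw [Pi.sub_apply, habc m i, habc n i]
    simp only [Pi.mul_apply, Pi.natCast_apply]
    have ha : (a m : ℝ) - a n = q * za := by exact_mod_cast hza
    have hb : (b m : ℝ) - b n = q * zb := by exact_mod_cast hzb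
    have hc : (c m : ℝ) - c n = q * zc := by exact_mod_cast hzc
    linear_combination ha + θ i * hb + θ i ^ 2 * hc
  have e2 : u ^ m = u ^ (m - n) * u ^ n := by rw [← pow_add]; congr 1; omega
  have e3 := (u ^ n).mul_inv
  rw [← mul_assoc, ← e1, e2, Units.val_mul]
  linear_combination (1 - ((u ^ (m-n) : (Fin 3 → ℝ)ˣ) : Fin 3 → ℝ)) * e3

lemma zt_transfer (θ : Fin 3 → ℝ) (h : ∀ i, θ i ^ 3 = 3 * θ i - 1) (i j : Fin 3)
    (P : Polynomial ℚ) (hP : Polynomial.aeval (θ i) P = 0) : Polynomial.aeval (θ j) P = 0 := by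
  have hirr : Irreducible (Polynomial.X ^ 3 - (Polynomial.C 3 * Polynomial.X - Polynomial.C 1) : Polynomial ℚ) := by
    have hdeg : (Polynomial.X ^ 3 - (Polynomial.C 3 * Polynomial.X - Polynomial.C 1) : Polynomial ℚ).natDegree = 3 := by
      compute_degree!
    rw [Polynomial.Monic.irreducible_iff_roots_eq_zero_of_degree_le_three]
    · rw [Multiset.eq_zero_iff_forall_notMem]
      intro x hx
      have hr := Polynomial.isRoot_of_mem_roots hx
      simp at hr
      have h3 : x ^ 3 = 3 * x - 1 := by linarith
      have hint : IsIntegral ℤ x := by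
        refine ⟨Polynomial.X ^ 3 - (Polynomial.C 3 * Polynomial.X - Polynomial.C 1), ?_, ?_⟩
        · apply Polynomial.monic_X_pow_sub
          compute_degree!
        · simp [h3]
      obtain ⟨y, rfl⟩ := IsIntegrallyClosed.isIntegral_iff.1 hint
      simp only [algebraMap_int_eq, eq_intCast] at h3
      have h4 : y ^ 3 = 3 * y - 1 := by exact_mod_cast h3
      have h5 : y ∣ 1 := ⟨3 - y ^ 2, by linear_combination h4⟩
      rcases Int.isUnit_iff.1 (isUnit_of_dvd_one h5) with rfl | rfl <;> norm_num at h4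
    · apply Polynomial.monic_X_pow_sub
      compute_degree!
    · rw [hdeg]; norm_num
    · rw [hdeg]
  have hm : (Polynomial.X ^ 3 - (Polynomial.C 3 * Polynomial.X - Polynomial.C 1) : Polynomial ℚ).Monic := by
    apply Polynomial.monic_X_pow_sub
    compute_degree!
  have hr : ∀ k, Polynomial.aeval (θ k) (Polynomial.X ^ 3 - (Polynomial.C 3 * Polynomial.X - Polynomial.C 1) : Polynomial ℚ) = 0 := by
    intro k; simp [h k]
  have hmin := minpoly.eq_of_irreducible_of_monic hirr (hr i) hm
  obtain ⟨Q, rfl⟩ := minpoly.dvd ℚ (θ i) hP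
  rw [← hmin, map_mul, hr j, zero_mul]

end FLproof

namespace FLproof

lemma zt_irr (θ : Fin 3 → ℝ) (h : ∀ i, θ i ^ 3 = 3 * θ i - 1)
    (h0 : -2 < θ 0 ∧ θ 0 < -1) (h1 : 0 < θ 1 ∧ θ 1 < 1/2) (h2 : 1 < θ 2 ∧ θ 2 < 8/5) (i : Fin 3) :
    Irrational (Real.log |θ i| / Real.log |θ i - 1|) := by
  have hla : Real.log |θ i| ≠ 0 ∧ Real.log |θ i - 1| ≠ 0 ∧ 0 < |θ i| ∧ 0 < |θ i - 1| := by
    have hA : ∀ x : ℝ, x ≠ 0 → x ≠ 1 → x ≠ -1 → Real.log |x| ≠ 0 := by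
      intro x a b c
      rw [Real.log_abs]
      intro hh; rcases Real.log_eq_zero.1 hh with hh | hh | hh <;> contradiction
    fin_cases i <;> simp only [Fin.zero_eta, Fin.mk_one, Fin.reduceFinMk] <;>
    refine ⟨hA _ ?_ ?_ ?_, hA _ ?_ ?_ ?_, abs_pos.2 ?_, abs_pos.2 ?_⟩ <;> intro hh <;> linarith
  obtain ⟨hl1, hl2, hp1, hp2⟩ := hla
  rintro ⟨x, hx⟩
  rw [eq_div_iff hl2, Rat.cast_def] at hx
  have hr : (x.den : ℝ) ≠ 0 := by exact_mod_cast x.den_nz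
  have hx : (x.num : ℝ) * Real.log |θ i - 1| = x.den * Real.log |θ i| := by
    field_simp at hx
    linarith
  have e1 : |θ i - 1| ^ (x.num) = |θ i| ^ x.den := by
    apply Real.log_injOn_pos (Set.mem_Ioi.2 (by positivity)) (Set.mem_Ioi.2 (by positivity))
    rw [Real.log_zpow, Real.log_pow, hx]
  have hden := x.den_pos
  rcases lt_trichotomy x.num 0 with hn | hn | hn
  · obtain ⟨p, hp⟩ := Int.exists_eq_neg_ofNat hn.le
    have hp0 : p ≠ 0 := by rintro rfl; rw [hp] at hn; simp at hn
    rw [hp, zpow_neg, zpow_natCast] at e1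
    have e2 : |θ i| ^ x.den * |θ i - 1| ^ p = 1 := by
      rw [← e1]; field_simp
    have e3 : (θ i ^ 2) ^ x.den * ((θ i - 1) ^ 2) ^ p = 1 := by
      rw [← sq_abs, ← sq_abs (θ i - 1), ← pow_mul, ← pow_mul, mul_comm 2, mul_comm 2, pow_mul, pow_mul,
        ← mul_pow, e2, one_pow]
    have := zt_transfer θ h i 0 ((Polynomial.X ^ 2) ^ x.den * ((Polynomial.X - 1) ^ 2) ^ p - 1)
      (by simp [e3])
    simp at this
    have k1 : 1 < (θ 0 ^ 2) ^ x.den := one_lt_pow₀ (by nlinarith) hden.ne'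
    have k2 : 1 < ((θ 0 - 1) ^ 2) ^ p := one_lt_pow₀ (by nlinarith) hp0
    nlinarith
  · rw [hn] at hx
    simp at hx
    exact absurd (by rw [Real.log_abs]; exact Real.log_eq_zero.2 hx) hl1
  · obtain ⟨p, hp⟩ := Int.eq_ofNat_of_zero_le hn.le
    have hp0 : p ≠ 0 := by rintro rfl; rw [hp] at hn; simp at hn
    rw [hp, zpow_natCast] at e1
    have e3 : (θ i ^ 2) ^ x.den = ((θ i - 1) ^ 2) ^ p := by
      rw [← sq_abs, ← sq_abs (θ i - 1), ← pow_mul, ← pow_mul, mul_comm 2, mul_comm 2, pow_mul, pow_mul,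
        e1]
    have := zt_transfer θ h i 2 ((Polynomial.X ^ 2) ^ x.den - ((Polynomial.X - 1) ^ 2) ^ p)
      (by simp [e3])
    simp at this
    have k1 : 1 < (θ 2 ^ 2) ^ x.den := one_lt_pow₀ (by nlinarith) hden.ne'
    have k2 : ((θ 2 - 1) ^ 2) ^ p < 1 := pow_lt_one₀ (by positivity) (by nlinarith) hp0
    linarith

theorem cubic_main : ∃ V : Matrix (Fin 3) (Fin 3) ℝ, 0 < V.det ∧
    ∀ v : Fin 3 → ℝ, ∃ n : ℤ, n ≠ 0 ∧ ∀ η > 0, ∃ m : Fin 3 → ℤ,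
      |∏ i, (V.mulVec (fun i => (m i : ℝ)) + (n : ℝ) • v) i| < η := by
  obtain ⟨θ, h, h0, h1, h2⟩ := exists_theta
  have hdet : 0 < (Matrix.vandermonde θ).det := by
    rw [Matrix.det_fin_three]
    simp [Matrix.vandermonde]
    have : 0 < (θ 1 - θ 0) * (θ 2 - θ 0) * (θ 2 - θ 1) := by
      have a : 0 < θ 1 - θ 0 := by linarith
      have b : 0 < θ 2 - θ 0 := by linarith
      have c : 0 < θ 2 - θ 1 := by linarith
      positivity
    nlinarith
  refine ⟨Matrix.vandermonde θ, hdet, fun v => ?_⟩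
  have hV : ∀ (t : Fin 3 → ℝ) i, (Matrix.vandermonde θ).mulVec t i = t 0 + t 1 * θ i + t 2 * θ i ^ 2 := by
    intro t i
    simp [Matrix.mulVec, dotProduct, Fin.sum_univ_three, Matrix.vandermonde]
    ring
  have hab : ∀ i, |θ i| ≤ 2 := by
    intro i
    rw [abs_le]
    fin_cases i <;> simp <;> constructor <;> linarith
  have hR : ∀ v : Fin 3 → ℝ, ∃ l ∈ ZTheta θ h, ‖v - l‖ ≤ 7 := by
    intro v
    have hu : IsUnit (Matrix.vandermonde θ).det := hdet.ne'.isUnit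
    set t := (Matrix.vandermonde θ)⁻¹.mulVec v with ht
    have hv : (Matrix.vandermonde θ).mulVec t = v := by
      rw [ht, Matrix.mulVec_mulVec, Matrix.mul_nonsing_inv _ hu, Matrix.one_mulVec]
    refine ⟨fun i => (⌊t 0⌋ : ℝ) + ⌊t 1⌋ * θ i + ⌊t 2⌋ * θ i ^ 2, ⟨_, _, _, fun i => rfl⟩, ?_⟩
    rw [pi_norm_le_iff_of_nonneg (by norm_num)]
    intro i
    have e : (v - fun i => (⌊t 0⌋ : ℝ) + ⌊t 1⌋ * θ i + ⌊t 2⌋ * θ i ^ 2) i =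
      Int.fract (t 0) + Int.fract (t 1) * θ i + Int.fract (t 2) * θ i ^ 2 := by
      rw [Pi.sub_apply, ← hv, hV]
      simp only [Int.fract]
      ring
    rw [e, Real.norm_eq_abs]
    have f0 : ∀ x : ℝ, |Int.fract x| ≤ 1 := fun x => by
      rw [abs_of_nonneg (Int.fract_nonneg x)]; exact (Int.fract_lt_one x).le
    calc _ ≤ |Int.fract (t 0)| + |Int.fract (t 1)| * |θ i| + |Int.fract (t 2)| * |θ i| ^ 2 := by
          refine (abs_add_le _ _).trans ?_
          rw [abs_mul, abs_pow]
          gcongr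
          refine (abs_add_le _ _).trans ?_
          rw [abs_mul]
      _ ≤ 1 + 1 * 2 + 1 * 2 ^ 2 := by
          gcongr <;> first | exact f0 _ | exact hab i
      _ = 7 := by norm_num
  have q01 : θ 0 ^ 2 + θ 0 * θ 1 + θ 1 ^ 2 = 3 := by
    have : (θ 1 - θ 0) * (θ 0 ^ 2 + θ 0 * θ 1 + θ 1 ^ 2 - 3) = 0 := by
      linear_combination h 1 - h 0
    rcases mul_eq_zero.1 this with h | h <;> linarith
  have q12 : θ 1 ^ 2 + θ 1 * θ 2 + θ 2 ^ 2 = 3 := by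
    have : (θ 2 - θ 1) * (θ 1 ^ 2 + θ 1 * θ 2 + θ 2 ^ 2 - 3) = 0 := by
      linear_combination h 2 - h 1
    rcases mul_eq_zero.1 this with h | h <;> linarith
  have qs : θ 0 + θ 1 + θ 2 = 0 := by
    have : (θ 2 - θ 0) * (θ 0 + θ 1 + θ 2) = 0 := by
      linear_combination q12 - q01
    rcases mul_eq_zero.1 this with h | h <;> linarith
  have q2 : θ 2 = - θ 0 - θ 1 := by linarith
  have qp : θ 0 * θ 1 * θ 2 = -1 := by
    rw [q2]; linear_combination h 0 - θ 0 * q01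
  have qp1 : (θ 0 - 1) * (θ 1 - 1) * (θ 2 - 1) = 1 := by
    have := qp
    rw [q2] at this ⊢
    linear_combination this + q01
  let u : (Fin 3 → ℝ)ˣ := ⟨θ, fun i => 3 - θ i ^ 2, by ext i; simp; linear_combination -h i,
    by ext i; simp; linear_combination -h i⟩
  let w : (Fin 3 → ℝ)ˣ := ⟨fun i => θ i - 1, fun i => θ i ^ 2 + θ i - 2,
    by ext i; simp; linear_combination h i, by ext i; simp; linear_combination h i⟩
  have hu : u ∈ GU (ZTheta θ h) 1 := by
    have m1 : θ ∈ ZTheta θ h := ⟨0, 1, 0, fun i => by simp⟩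
    refine ⟨m1, ⟨3, 0, -1, fun i => ?_⟩, ⟨θ - 1, (ZTheta θ h).sub_mem m1 (ZTheta θ h).one_mem, ?_⟩, ?_⟩
    · change 3 - θ i ^ 2 = _
      push_cast; ring
    · simp [u]
    · simp [u, Fin.prod_univ_three, qp]
  have hw : w ∈ GU (ZTheta θ h) 1 := by
    have m1 : (fun i => θ i - 1) ∈ ZTheta θ h := ⟨-1, 1, 0, fun i => by push_cast; ring⟩
    refine ⟨m1, ⟨-2, 1, 1, fun i => ?_⟩, ⟨(fun i => θ i - 1) - 1, (ZTheta θ h).sub_mem m1 (ZTheta θ h).one_mem, ?_⟩, ?_⟩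
    · change θ i ^ 2 + θ i - 2 = _
      push_cast; ring
    · simp [w]
    · simp [w, Fin.prod_univ_three, qp1]
  have hu' : ∀ i, (u : Fin 3 → ℝ) i = θ i := fun i => rfl
  have hw' : ∀ i, (w : Fin 3 → ℝ) i = θ i - 1 := fun i => rfl
  have hinv : ∀ (z : (Fin 3 → ℝ)ˣ) i, ((z⁻¹ : (Fin 3 → ℝ)ˣ) : Fin 3 → ℝ) i = ((z : Fin 3 → ℝ) i)⁻¹ := by
    intro z i
    exact eq_inv_of_mul_eq_one_left (congrFun z.inv_mul i)
  have n0 : |θ 0| = - θ 0 := abs_of_neg (by linarith)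
  have n1 : |θ 1| = θ 1 := abs_of_pos (by linarith)
  have n2 : |θ 2| = θ 2 := abs_of_pos (by linarith)
  have k0 : |θ 0 - 1| = 1 - θ 0 := by rw [abs_of_neg (by linarith)]; ring
  have k1 : |θ 1 - 1| = 1 - θ 1 := by rw [abs_of_neg (by linarith)]; ring
  have k2 : |θ 2 - 1| = θ 2 - 1 := abs_of_pos (by linarith)
  have hdom : ∀ i, ∃ u ∈ GU (ZTheta θ h) 1, 1 < |(u : Fin 3 → ℝ) i| ∧
      ∀ j ≠ i, |(u : Fin 3 → ℝ) j| < 1 := by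
    intro i
    have t1 : ∀ x : ℝ, 1 < x → x⁻¹ < 1 := fun x hx => inv_lt_one_of_one_lt₀ hx
    have t2 : ∀ x : ℝ, 0 < x → x < 1 → 1 < x⁻¹ := fun x hx h => (one_lt_inv₀ hx).2 h
    fin_cases i
    · refine ⟨u * w, Subgroup.mul_mem _ hu hw, ?_, ?_⟩
      · simp only [Units.val_mul, Pi.mul_apply, hu', hw', abs_mul, Fin.zero_eta, n0, k0]
        nlinarith
      · intro j hj
        fin_cases j
        · simp at hj
        · simp only [Units.val_mul, Pi.mul_apply, hu', hw', abs_mul, Fin.mk_one, n1, k1]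
          nlinarith
        · simp only [Units.val_mul, Pi.mul_apply, hu', hw', abs_mul, Fin.reduceFinMk, n2, k2]
          nlinarith
    · refine ⟨u⁻¹, Subgroup.inv_mem _ hu, ?_, ?_⟩
      · simp only [hinv, hu', abs_inv, Fin.mk_one, n1]
        exact t2 _ (by linarith) (by linarith)
      · intro j hj
        fin_cases j
        · simp only [hinv, hu', abs_inv, Fin.zero_eta, n0]
          exact t1 _ (by linarith)
        · simp at hj
        · simp only [hinv, hu', abs_inv, Fin.reduceFinMk, n2]
          exact t1 _ (by linarith)
    · refine ⟨u * w⁻¹, Subgroup.mul_mem _ hu (Subgroup.inv_mem _ hw), ?_, ?_⟩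
      · simp only [Units.val_mul, Pi.mul_apply, hu', hw', abs_mul, hinv, abs_inv, Fin.reduceFinMk, n2, k2]
        rw [← div_eq_mul_inv, one_lt_div (by linarith)]
        linarith
      · intro j hj
        fin_cases j
        · simp only [Units.val_mul, Pi.mul_apply, hu', hw', abs_mul, hinv, abs_inv, Fin.zero_eta, n0, k0]
          rw [← div_eq_mul_inv, div_lt_one (by linarith)]
          linarith
        · simp only [Units.val_mul, Pi.mul_apply, hu', hw', abs_mul, hinv, abs_inv, Fin.mk_one, n1, k1]
          rw [← div_eq_mul_inv, div_lt_one (by linarith)]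
          linarith
        · simp at hj
  obtain ⟨n, hn, hη⟩ := torus_main (ZTheta θ h) 7 hR (zt_tors θ h) (zt_per θ h) hdom
    (fun i => ⟨u, hu, w, hw, zt_irr θ h h0 h1 h2 i⟩) v
  refine ⟨n, hn, fun η hη0 => ?_⟩
  obtain ⟨l, ⟨a, b, c, hl⟩, hlt⟩ := hη η hη0
  refine ⟨![a, b, c], ?_⟩
  have hfun : ((Matrix.vandermonde θ).mulVec fun i => ((![a, b, c] i : ℤ) : ℝ)) + (n : ℝ) • v =
      (n : Fin 3 → ℝ) * v + l := by
   ext i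
   rw [Pi.add_apply, Pi.add_apply, hV, hl]
   simp
   ring
  rw [hfun]
  exact hlt

end FLproof

namespace FLproof

/-- integer vectors as real vectors -/
abbrev zv {d : ℕ} (m : Fin d → ℤ) : Fin d → ℝ := fun i => (m i : ℝ)

/-- integer matrices as real matrices -/
abbrev zm {d : ℕ} (m : Matrix (Fin d) (Fin d) ℤ) : Matrix (Fin d) (Fin d) ℝ := m.map (Int.cast : ℤ → ℝ)

def Good {d : ℕ} (G : Matrix (Fin d) (Fin d) ℝ) : Prop :=
  ∀ v : Fin d → ℝ, ∃ n : ℤ, n ≠ 0 ∧ ∀ η > 0, ∃ m : Fin d → ℤ,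
    |∏ i, (G.mulVec (zv m) + (n : ℝ) • v) i| < η

theorem exists_good (d : ℕ) (hd : 3 ≤ d) : ∃ G : Matrix (Fin d) (Fin d) ℝ, G.det = 1 ∧ Good G := by
  obtain ⟨e, rfl⟩ := Nat.exists_eq_add_of_le hd
  obtain ⟨V, hV, hgood⟩ := cubic_main
  set c : ℝ := (V.det) ^ (-(1/3) : ℝ) with hc
  have hc0 : 0 < c := Real.rpow_pos_of_pos hV _
  have hc3 : c ^ 3 * V.det = 1 := by
    rw [hc, ← Real.rpow_natCast, ← Real.rpow_mul hV.le]
    norm_num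
    rw [Real.rpow_neg_one, inv_mul_cancel₀ hV.ne']
  set M : Matrix (Fin 3 ⊕ Fin e) (Fin 3 ⊕ Fin e) ℝ := Matrix.fromBlocks (c • V) 0 0 1 with hM
  refine ⟨Matrix.reindex finSumFinEquiv finSumFinEquiv M, ?_, ?_⟩
  · rw [Matrix.det_reindex_self, hM, Matrix.det_fromBlocks_zero₂₁, Matrix.det_smul]
    simpa using hc3
  intro v
  obtain ⟨n, hn, hη⟩ := hgood (c⁻¹ • fun i => v (Fin.castAdd e i))
  refine ⟨n, hn, fun η hη0 => ?_⟩
  obtain ⟨m, hm⟩ := hη (η / c ^ 3) (by positivity)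
  refine ⟨Sum.elim m (fun j => -⌊n * v (Fin.natAdd 3 j)⌋) ∘ finSumFinEquiv.symm, ?_⟩
  rw [Matrix.reindex_apply, Matrix.submatrix_mulVec_equiv]
  rw [Fin.prod_univ_add, abs_mul]
  have e1 : ∀ i : Fin 3, ((M.mulVec ((zv (Sum.elim m (fun j => -⌊n * v (Fin.natAdd 3 j)⌋) ∘ finSumFinEquiv.symm)) ∘ finSumFinEquiv.symm.symm)) ∘ finSumFinEquiv.symm + (n:ℝ) • v) (Fin.castAdd e i)
     = c * (V.mulVec (fun i => (m i : ℝ)) + (n:ℝ) • (c⁻¹ • fun i => v (Fin.castAdd e i))) i := by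
    intro i
    simp [hM, Matrix.fromBlocks_mulVec, mul_add]
    congr 1
    · rw [Matrix.smul_mulVec]
      simp
      left
      congr 1
      ext i
      simp
    · field_simp
  have e2 : ∀ i : Fin e, ((M.mulVec ((zv (Sum.elim m (fun j => -⌊n * v (Fin.natAdd 3 j)⌋) ∘ finSumFinEquiv.symm)) ∘ finSumFinEquiv.symm.symm)) ∘ finSumFinEquiv.symm + (n:ℝ) • v) (Fin.natAdd 3 i)
     = Int.fract (n * v (Fin.natAdd 3 i)) := by
    intro i
    simp [hM, Matrix.fromBlocks_mulVec, zv]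
    rw [← Int.self_sub_floor]; ring
  rw [Finset.prod_congr rfl (fun i _ => e1 i), Finset.prod_congr rfl (fun i _ => e2 i),
    Finset.prod_mul_distrib, abs_mul]
  have h1 : |∏ i : Fin e, Int.fract (n * v (Fin.natAdd 3 i))| ≤ 1 := by
    rw [Finset.abs_prod]
    apply Finset.prod_le_one
    · intro i _; positivity
    · intro i _
      rw [abs_of_nonneg (Int.fract_nonneg _)]; exact (Int.fract_lt_one _).le
  rw [lt_div_iff₀ (by positivity)] at hm
  simp only [Finset.prod_const, Finset.card_univ, Fintype.card_fin]
  rw [abs_of_pos (show (0:ℝ) < c ^ 3 by positivity)]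
  calc _ ≤ (c ^ 3 * |∏ i, (V.mulVec (fun i => (m i : ℝ)) + (n:ℝ) • (c⁻¹ • fun i => v (Fin.castAdd e i))) i|) * 1 := by
        gcongr
    _ < η := by rw [mul_one, mul_comm]; exact hm

lemma inherit_cont {d : ℕ} (n : ℤ) (m : Fin d → ℤ) :
    Continuous fun p : Matrix (Fin d) (Fin d) ℝ × (Fin d → ℝ) =>
        |∏ i, (p.1.mulVec (zv m) + (n:ℝ) • p.1.mulVec p.2) i| := by
  have e1 : Continuous fun p : Matrix (Fin d) (Fin d) ℝ × (Fin d → ℝ) => p.1.mulVec (zv m) :=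
    Continuous.matrix_mulVec continuous_fst continuous_const
  have e2 : Continuous fun p : Matrix (Fin d) (Fin d) ℝ × (Fin d → ℝ) => p.1.mulVec p.2 :=
    Continuous.matrix_mulVec continuous_fst continuous_snd
  apply Continuous.abs
  apply continuous_finsetProd
  intro i _
  exact ((continuous_apply i).comp e1).add (continuous_const.mul ((continuous_apply i).comp e2))

lemma inherit_tendsto {d : ℕ} (n : ℤ) (m : Fin d → ℤ) (A : ℕ → Matrix (Fin d) (Fin d) ℝ)
    (x : ℕ → Fin d → ℝ) (g0 : Matrix (Fin d) (Fin d) ℝ) (c : Fin d → ℝ)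
    (hA : Filter.Tendsto A Filter.atTop (nhds g0)) (hx : Filter.Tendsto x Filter.atTop (nhds c)) :
    Filter.Tendsto (fun k => |∏ i, ((A k).mulVec (zv m) + (n:ℝ) • (A k).mulVec (x k)) i|)
      Filter.atTop (nhds |∏ i, (g0.mulVec (zv m) + (n:ℝ) • g0.mulVec c) i|) :=
  by
  have h := ((inherit_cont n m).tendsto (g0, c))
  have h2 := (hA.prodMk_nhds hx)
  have h3 := Filter.Tendsto.comp h h2
  simp only [Function.comp_def] at h3
  exact h3

theorem inherit {d : ℕ} (g0 : Matrix (Fin d) (Fin d) ℝ) (hgood : Good g0) (g : SLd d)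
    (a : ℕ → Fin d → ℝ) (ha : ∀ k, |∏ i, a k i| = 1) (γ : ℕ → Matrix (Fin d) (Fin d) ℤ)
    (hγ : ∀ k, (γ k).det = 1)
    (hlim : Filter.Tendsto (fun k => Matrix.diagonal (a k) * (g : Matrix (Fin d) (Fin d) ℝ) * zm (γ k))
      Filter.atTop (nhds g0)) : IsGFL (latticeOf g) := by
  intro v
  set H := fun k => Matrix.diagonal (a k) * (g : Matrix (Fin d) (Fin d) ℝ) * zm (γ k) with hH
  have hdet : ∀ k, IsUnit (H k).det := by
    intro k
    rw [hH]
    simp only [Matrix.det_mul, Matrix.det_diagonal, g.2]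
    have : (zm (γ k)).det = 1 := by
      have := (Int.castRingHom ℝ).map_det (γ k)
      rw [hγ k] at this
      simpa using this.symm
    rw [this]
    have := ha k
    simp only [mul_one, isUnit_iff_ne_zero]
    intro h; rw [h] at this; simp at this
  set b : ℕ → Fin d → ℝ := fun k => (H k)⁻¹.mulVec (a k * v) with hb
  have hHb : ∀ k, (H k).mulVec (b k) = a k * v := by
    intro k
    rw [hb]
    simp only
    rw [Matrix.mulVec_mulVec, Matrix.mul_nonsing_inv _ (hdet k), Matrix.one_mulVec]
  set f : ℕ → Fin d → ℝ := fun k i => Int.fract (b k i) with hf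
  have hfm : ∀ k, f k ∈ Set.Icc (0 : Fin d → ℝ) 1 := fun k =>
    ⟨fun i => Int.fract_nonneg _, fun i => (Int.fract_lt_one _).le⟩
  obtain ⟨c, -, φ, hφ, hc⟩ := isCompact_Icc.tendsto_subseq hfm
  obtain ⟨n, hn, hη⟩ := hgood (g0.mulVec c)
  refine ⟨n, hn, ?_⟩
  have hnn : ∀ r ∈ {r : ℝ | ∃ w ∈ grid (latticeOf g) ((n:ℝ) • v), r = |∏ i, w i|}, 0 ≤ r := by
    rintro r ⟨w, -, rfl⟩; positivity
  apply le_antisymm _ (Real.sInf_nonneg hnn)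
  apply le_of_forall_pos_le_add
  intro η hη0
  rw [zero_add]
  obtain ⟨m, hm⟩ := hη η hη0
  have ht : Filter.Tendsto (fun k => |∏ i, ((H (φ k)).mulVec (zv m) + (n:ℝ) • (H (φ k)).mulVec (f (φ k))) i|)
      Filter.atTop (nhds |∏ i, (g0.mulVec (zv m) + (n:ℝ) • g0.mulVec c) i|) := by
    exact inherit_tendsto n m (fun k => H (φ k)) (fun k => f (φ k)) g0 c
      (hlim.comp hφ.tendsto_atTop) hc
  obtain ⟨k, hk⟩ := (ht.eventually (gt_mem_nhds hm)).exists
  refine (csInf_le ⟨0, fun r hr => hnn r hr⟩ ?_).trans hk.le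
  set m' : Fin d → ℤ := fun i => m i - n * ⌊b (φ k) i⌋ with hm'
  refine ⟨_, ⟨_, ⟨(γ (φ k)).mulVec m', rfl⟩, rfl⟩, ?_⟩
  have ez : (fun i => (((γ (φ k)).mulVec m' i : ℤ) : ℝ)) = (zm (γ (φ k))).mulVec (zv m') := by
    ext i
    simp [Matrix.mulVec, dotProduct]
  simp only [ez]
  have e3 : (H (φ k)).mulVec (zv m) + (n:ℝ) • (H (φ k)).mulVec (f (φ k)) =
      a (φ k) * ((g : Matrix (Fin d) (Fin d) ℝ).mulVec ((zm (γ (φ k))).mulVec (zv m')) + (n:ℝ) • v) := by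
    have e4 : f (φ k) = b (φ k) - zv (fun i => ⌊b (φ k) i⌋) := by
      ext i; simp only [hf, Pi.sub_apply]; rw [← Int.self_sub_floor]
    have e5 : zv m' = zv m - (n:ℝ) • zv (fun i => ⌊b (φ k) i⌋) := by
      ext i; simp [hm']
    rw [e4, Matrix.mulVec_sub, hHb]
    have e6 : a (φ k) * (g : Matrix (Fin d) (Fin d) ℝ).mulVec ((zm (γ (φ k))).mulVec (zv m')) =
        (H (φ k)).mulVec (zv m') := by
      rw [hH]
      simp only [← Matrix.mulVec_mulVec]
      ext i
      simp [Matrix.mulVec_diagonal]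
    rw [mul_add, e6, e5, Matrix.mulVec_sub, Matrix.mulVec_smul]
    ext i
    simp
    ring
  rw [e3]
  simp only [Pi.mul_apply]
  rw [Finset.prod_mul_distrib, abs_mul, ha, one_mul]

end FLproof

namespace FLproof

/-- lower triangular -/
def LowTri {d : ℕ} (p : Matrix (Fin d) (Fin d) ℝ) : Prop := ∀ i j, i < j → p i j = 0

lemma lowTri_iff {d : ℕ} (p : Matrix (Fin d) (Fin d) ℝ) :
    LowTri p ↔ p.BlockTriangular OrderDual.toDual := by
  constructor
  · intro h i j hij
    exact h i j hij
  · intro h i j hij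
    exact h hij

lemma LowTri.mul {d : ℕ} {p q : Matrix (Fin d) (Fin d) ℝ} (hp : LowTri p) (hq : LowTri q) :
    LowTri (p * q) := by
  rw [lowTri_iff] at *
  exact Matrix.BlockTriangular.mul hp hq

lemma LowTri.inv {d : ℕ} {p : Matrix (Fin d) (Fin d) ℝ} (hp : LowTri p) (h : p.det ≠ 0) :
    LowTri p⁻¹ := by
  rw [lowTri_iff] at *
  have := Matrix.invertibleOfIsUnitDet p h.isUnit
  exact Matrix.blockTriangular_inv_of_blockTriangular hp

lemma lowTri_diag {d : ℕ} (a : Fin d → ℝ) : LowTri (Matrix.diagonal a) := by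
  intro i j hij
  exact Matrix.diagonal_apply_ne _ hij.ne

lemma mat_subseq {d : ℕ} (A : ℕ → Matrix (Fin d) (Fin d) ℝ) (R : ℝ) (h : ∀ k i j, |A k i j| ≤ R) :
    ∃ (B : Matrix (Fin d) (Fin d) ℝ) (φ : ℕ → ℕ), StrictMono φ ∧
      Filter.Tendsto (fun k => A (φ k)) Filter.atTop (nhds B) := by
  have hc : IsCompact (Set.Icc (fun _ _ => -R : Fin d → Fin d → ℝ) (fun _ _ => R)) := isCompact_Icc
  let A' : ℕ → Fin d → Fin d → ℝ := fun k i j => A k i j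
  obtain ⟨B, -, φ, hφ, hB⟩ := hc.tendsto_subseq (x := A')
    (fun k => ⟨fun i j => (abs_le.1 (h k i j)).1, fun i j => (abs_le.1 (h k i j)).2⟩)
  exact ⟨B, φ, hφ, hB⟩

lemma tendsto_entry {d : ℕ} {A : ℕ → Matrix (Fin d) (Fin d) ℝ} {B : Matrix (Fin d) (Fin d) ℝ}
    (h : Filter.Tendsto A Filter.atTop (nhds B)) (i j : Fin d) :
    Filter.Tendsto (fun k => A k i j) Filter.atTop (nhds (B i j)) :=
  ((continuous_id.matrix_elem i j).tendsto B).comp h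

lemma orthogonalize {d : ℕ} (M : Matrix (Fin d) (Fin d) ℝ) (hM : M.det ≠ 0) :
    ∃ T : Matrix (Fin d) (Fin d) ℝ, LowTri T ∧ T.det ≠ 0 ∧ (T * M) * (T * M).transpose = 1 := by
  have hS : (M * M.transpose).PosDef := by
    have := Matrix.PosDef.mul_conjTranspose_self M
      (Matrix.vecMul_injective_iff_isUnit.2 ((Matrix.isUnit_iff_isUnit_det M).2 hM.isUnit))
    simpa [Matrix.conjTranspose_eq_transpose_of_trivial] using this
  set T0 := LDL.lowerInv hS with hT0
  have hT0det : T0.det ≠ 0 := by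
    have := (Matrix.isUnit_iff_isUnit_det T0).1 (isUnit_of_invertible T0)
    exact this.ne_zero
  have h1 := LDL.diag_eq_lowerInv_conj hS
  rw [← hT0, LDL.diag, Matrix.conjTranspose_eq_transpose_of_trivial] at h1
  set D := LDL.diagEntries hS
  have h2 : Matrix.diagonal D = (T0 * M) * (T0 * M).transpose := by
    rw [h1, Matrix.transpose_mul]; simp only [Matrix.mul_assoc]
  have h3 : ∏ i, D i ≠ 0 := by
    rw [← Matrix.det_diagonal, h2, Matrix.det_mul, Matrix.det_transpose, Matrix.det_mul]
    have := mul_ne_zero hT0det hM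
    exact mul_ne_zero this this
  have h4 : ∀ i, 0 ≤ D i := by
    intro i
    have : D i = ((T0 * M) * (T0 * M).transpose) i i := by
      rw [← h2, Matrix.diagonal_apply_eq]
    rw [this, Matrix.mul_apply]
    apply Finset.sum_nonneg
    intro j _
    rw [Matrix.transpose_apply]
    exact mul_self_nonneg _
  have h5 : ∀ i, 0 < D i := fun i =>
    lt_of_le_of_ne (h4 i) (Ne.symm (Finset.prod_ne_zero_iff.1 h3 i (Finset.mem_univ i)))
  have h6 : ∀ i, (Real.sqrt (D i)) ≠ 0 := fun i => (Real.sqrt_pos.2 (h5 i)).ne'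
  refine ⟨Matrix.diagonal (fun i => (Real.sqrt (D i))⁻¹) * T0, ?_, ?_, ?_⟩
  · exact (lowTri_diag _).mul (fun i j hij => LDL.lowerInv_triangular hS hij)
  · rw [Matrix.det_mul, Matrix.det_diagonal]
    exact mul_ne_zero (Finset.prod_ne_zero_iff.2 fun i _ => inv_ne_zero (h6 i)) hT0det
  · rw [Matrix.mul_assoc (Matrix.diagonal _), Matrix.transpose_mul (Matrix.diagonal _), Matrix.diagonal_transpose]
    rw [Matrix.mul_assoc (Matrix.diagonal _), ← Matrix.mul_assoc (T0 * M), ← h2, Matrix.diagonal_mul_diagonal,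
      Matrix.diagonal_mul_diagonal, ← Matrix.diagonal_one]
    congr 1
    ext i
    have := Real.mul_self_sqrt (h4 i)
    have h6 := h6 i
    field_simp
    linarith

lemma orth_bound {d : ℕ} (O : Matrix (Fin d) (Fin d) ℝ) (h : O * O.transpose = 1) (i j : Fin d) :
    |O i j| ≤ 1 := by
  have h1 : ∑ k, O i k * O i k = 1 := by
    have := congrFun (congrFun h i) i
    simpa [Matrix.mul_apply] using this
  have h2 := Finset.single_le_sum (f := fun k => O i k * O i k) (fun k _ => mul_self_nonneg _)
    (Finset.mem_univ j)
  have h3 : O i j * O i j ≤ 1 := by rw [← h1]; exact h2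
  rw [abs_le]
  constructor <;> nlinarith

lemma transv_entry {d : ℕ} (O : Matrix (Fin d) (Fin d) ℝ) (i j : Fin d) (c : ℝ) (a b : Fin d) :
    (O * Matrix.transvection i j c) a b = O a b + if b = j then c * O a i else 0 := by
  by_cases hb : b = j
  · subst hb
    simp [Matrix.mul_transvection_apply_same]
  · rw [Matrix.mul_transvection_apply_of_ne (hb := hb)]
    simp [hb]

lemma S3core {d : ℕ} (S : Set (Matrix (Fin d) (Fin d) ℝ)) (hS : IsClosed S)
    (hP : ∀ p, LowTri p → p.det ≠ 0 → ∀ M ∈ S, p * M ∈ S)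
    (hE : ∀ i j, i ≠ j → ∃ N : ℝ, N ≠ 0 ∧ ∀ n : ℕ, ∀ M ∈ S, M * Matrix.transvection i j (N * n) ∈ S)
    (hne : ∃ M ∈ S, M.det ≠ 0) : 1 ∈ S := by
  have hdetO : ∀ O : Matrix (Fin d) (Fin d) ℝ, O * O.transpose = 1 → O.det ≠ 0 := by
    intro O hO
    have := congrArg Matrix.det hO
    rw [Matrix.det_mul, Matrix.det_one] at this
    exact left_ne_zero_of_mul_eq_one this
  have main : ∀ j : ℕ, j ≤ d → ∃ O ∈ S, O * O.transpose = 1 ∧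
      ∀ l m : Fin d, (l : ℕ) < j → l < m → O l m = 0 := by
    intro j
    induction j with
    | zero =>
      intro _
      obtain ⟨M, hM, hd⟩ := hne
      obtain ⟨T, hT, hTd, hTM⟩ := orthogonalize M hd
      exact ⟨T * M, hP T hT hTd M hM, hTM, by simp⟩
    | succ j ih =>
      intro hj
      obtain ⟨O, hO, hO1, hO2⟩ := ih (by omega)
      set J : Fin d := ⟨j, by omega⟩ with hJ
      by_cases hall : ∀ m, J < m → O J m = 0
      · refine ⟨O, hO, hO1, fun l m hl hm => ?_⟩
        rcases Nat.lt_succ_iff_lt_or_eq.1 hl with h | h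
        · exact hO2 l m h hm
        · have : l = J := Fin.ext h
          subst this
          exact hall m hm
      push Not at hall
      obtain ⟨i, hi, hri⟩ := hall
      obtain ⟨N, hN, hNS⟩ := hE i J hi.ne'
      set M : ℕ → Matrix (Fin d) (Fin d) ℝ := fun n => O * Matrix.transvection i J (N * n) with hMdef
      have hMe : ∀ n a b, M n a b = O a b + if b = J then (N * n) * O a i else 0 := fun n a b =>
        transv_entry O i J _ a b
      have hMd : ∀ n, (M n).det ≠ 0 := by
        intro n
        rw [hMdef]
        simp only [Matrix.det_mul, Matrix.det_transvection_of_ne i J hi.ne', mul_one]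
        exact hdetO O hO1
      choose T hT hTd hTM using fun n => orthogonalize (M n) (hMd n)
      obtain ⟨B, φ, hφ, hB⟩ := mat_subseq (fun n => T n * M n) 1
        (fun k i j => orth_bound _ (hTM k) i j)
      have hMlow : ∀ n (l m : Fin d), (l : ℕ) < j → l < m → M n l m = 0 := by
        intro n l m hl hm
        rw [hMe, hO2 l m hl hm, hO2 l i hl (lt_trans (show l < J from hl) hi)]
        simp
      have hTMlow : ∀ n (l m : Fin d), (l : ℕ) < j → l < m → (T n * M n) l m = 0 := by
        intro n l m hl hm
        rw [Matrix.mul_apply]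
        apply Finset.sum_eq_zero
        intro k _
        rcases lt_or_ge l k with h | h
        · rw [hT n l k h, zero_mul]
        · rw [hMlow n k m (lt_of_le_of_lt h hl) (lt_of_le_of_lt h hm), mul_zero]
      have hrow : ∀ n (m : Fin d), J ≤ m → (T n * M n) J m = T n J J * M n J m := by
        intro n m hm
        rw [Matrix.mul_apply]
        apply Finset.sum_eq_single J
        · intro k _ hk
          rcases lt_or_gt_of_ne hk with h | h
          · rw [hMlow n k m h (lt_of_lt_of_le h hm), mul_zero]
          · rw [hT n J k h, zero_mul]
        · simp
      have htau : Filter.Tendsto (fun n => T n J J) Filter.atTop (nhds 0) := by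
        have hdiv : Filter.Tendsto (fun n : ℕ => |O J J + (N * n) * O J i|) Filter.atTop Filter.atTop := by
          have h1 : Filter.Tendsto (fun n : ℕ => |N * O J i| * n - |O J J|) Filter.atTop Filter.atTop := by
            apply Filter.tendsto_atTop_add_const_right
            apply Filter.Tendsto.const_mul_atTop (abs_pos.2 (mul_ne_zero hN hri))
            exact tendsto_natCast_atTop_atTop
          apply Filter.tendsto_atTop_mono _ h1
          intro n
          have h2 : |N * O J i| * n = |(O J J + (N * n) * O J i) - O J J| := by
            rw [← abs_of_nonneg (Nat.cast_nonneg (α := ℝ) n), ← abs_mul]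
            congr 1
            rw [abs_of_nonneg (Nat.cast_nonneg (α := ℝ) n)]; ring
          have := abs_sub (O J J + (N * n) * O J i) (O J J)
          linarith
        have hinv := hdiv.inv_tendsto_atTop
        apply squeeze_zero_norm' _ hinv
        filter_upwards [hdiv.eventually_gt_atTop 0] with n hn
        have h1 := orth_bound _ (hTM n) J J
        rw [hrow n J le_rfl, hMe, if_pos rfl, abs_mul] at h1
        rw [Real.norm_eq_abs, Pi.inv_apply, ← one_div, le_div_iff₀ hn]
        exact h1
      refine ⟨B, hS.mem_of_tendsto hB (Filter.Eventually.of_forall fun k =>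
        hP _ (hT _) (hTd _) _ (hNS _ _ hO)), ?_, ?_⟩
      · have hc : Continuous fun X : Matrix (Fin d) (Fin d) ℝ => X * X.transpose :=
          continuous_id.matrix_mul continuous_id.matrix_transpose
        have h1 := (hc.tendsto B).comp hB
        have h2 : ((fun X : Matrix (Fin d) (Fin d) ℝ => X * X.transpose) ∘ fun k => T (φ k) * M (φ k)) =
          fun _ => 1 := by
          ext1 k; exact hTM _
        rw [h2] at h1
        exact tendsto_nhds_unique h1 tendsto_const_nhds
      · intro l m hl hm
        have hent := tendsto_entry hB l m
        rcases Nat.lt_succ_iff_lt_or_eq.1 hl with h | h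
        · have : (fun k => (T (φ k) * M (φ k)) l m) = fun _ => 0 := by
            ext1 k; exact hTMlow _ l m h hm
          rw [this] at hent
          exact tendsto_nhds_unique hent tendsto_const_nhds
        · have hl' : l = J := Fin.ext h
          subst hl'
          have : (fun k => (T (φ k) * M (φ k)) J m) = fun k => T (φ k) J J * O J m := by
            ext1 k
            rw [hrow _ m hm.le, hMe, if_neg hm.ne', add_zero]
          rw [this] at hent
          have h0 := (htau.comp hφ.tendsto_atTop).mul_const (O J m)
          rw [zero_mul] at h0
          exact tendsto_nhds_unique hent h0
  obtain ⟨O, hO, hO1, hO2⟩ := main d le_rfl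
  have hlow : LowTri O := fun l m h => hO2 l m l.2 h
  have := hP O⁻¹ (hlow.inv (hdetO O hO1)) (by
    rw [Matrix.det_nonsing_inv]
    simpa using (hdetO O hO1)) O hO
  rwa [Matrix.nonsing_inv_mul _ (hdetO O hO1).isUnit] at this

end FLproof

namespace FLproof

lemma zm_mul {d : ℕ} (a b : Matrix (Fin d) (Fin d) ℤ) : zm (a * b) = zm a * zm b :=
  Matrix.map_mul (f := Int.castRingHom ℝ)

lemma zm_det {d : ℕ} (a : Matrix (Fin d) (Fin d) ℤ) : (zm a).det = (a.det : ℝ) :=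
  ((Int.castRingHom ℝ).map_det a).symm

lemma clear_denoms {d : ℕ} (A : Matrix (Fin d) (Fin d) ℚ) :
    ∃ N : ℕ, 0 < N ∧ ∃ B : Matrix (Fin d) (Fin d) ℤ, ∀ i j, (N : ℚ) * A i j = B i j := by
  refine ⟨∏ i, ∏ j, (A i j).den, Finset.prod_pos fun i _ => Finset.prod_pos fun j _ => (A i j).den_pos, ?_⟩
  have : ∀ i j, ∃ b : ℤ, ((∏ i, ∏ j, (A i j).den : ℕ) : ℚ) * A i j = b := by
    intro i j
    obtain ⟨c, hc⟩ : (A i j).den ∣ ∏ i, ∏ j, (A i j).den :=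
      (Finset.dvd_prod_of_mem (fun j => (A i j).den) (Finset.mem_univ j)).trans
        (Finset.dvd_prod_of_mem (fun i => ∏ j, (A i j).den) (Finset.mem_univ i))
    refine ⟨c * (A i j).num, ?_⟩
    rw [hc]
    push_cast
    have := Rat.mul_den_eq_num (A i j)
    linear_combination (c : ℚ) * this
  choose B hB using this
  exact ⟨B, hB⟩

lemma exists_rat_matrix {d : ℕ} (U : Set (Matrix (Fin d) (Fin d) ℝ)) (hU : IsOpen U)
    (hne : U.Nonempty) : ∃ Q : Matrix (Fin d) (Fin d) ℚ, Q.map (Rat.cast : ℚ → ℝ) ∈ U := by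
  have h : DenseRange (Pi.map (fun _ : Fin d => (Pi.map (fun _ : Fin d => (Rat.cast : ℚ → ℝ))))) :=
    DenseRange.piMap fun i => DenseRange.piMap fun j => Rat.denseRange_cast
  obtain ⟨Q, hQ⟩ := h.exists_mem_open (s := (U : Set (Fin d → Fin d → ℝ))) hU hne
  exact ⟨Q, hQ⟩

theorem S3 {d : ℕ} (hd : 0 < d) (g g0 : Matrix (Fin d) (Fin d) ℝ) (hg : g.det = 1) (hg0 : g0.det = 1)
    (U : Set (Matrix (Fin d) (Fin d) ℝ)) (hU : IsOpen U) (h0 : g0 ∈ U) :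
    ∃ p : Matrix (Fin d) (Fin d) ℝ, LowTri p ∧ p.det = 1 ∧ ∃ γ : Matrix (Fin d) (Fin d) ℤ,
      γ.det = 1 ∧ p * g * zm γ ∈ U := by
  set i0 : Fin d := ⟨0, hd⟩
  set D : ℝ → Matrix (Fin d) (Fin d) ℝ := fun t => Matrix.diagonal (Function.update 1 i0 t⁻¹) with hD
  have hDc : ContinuousAt (fun M : Matrix (Fin d) (Fin d) ℝ => D M.det * M) g0 := by
    have h1 : ContinuousAt (fun M : Matrix (Fin d) (Fin d) ℝ => (M.det)⁻¹) g0 :=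
      (continuous_id.matrix_det.continuousAt).inv₀ (by rw [id, hg0]; norm_num)
    have h2 : Continuous (fun q : ℝ × Matrix (Fin d) (Fin d) ℝ => 
        Matrix.diagonal (Function.update (1 : Fin d → ℝ) i0 q.1) * q.2) := by
      apply Continuous.matrix_mul _ continuous_snd
      apply Continuous.matrix_diagonal
      exact continuous_const.update i0 continuous_fst
    exact ContinuousAt.comp (f := fun M : Matrix (Fin d) (Fin d) ℝ => ((M.det)⁻¹, M))
      (h2.continuousAt (x := ((g0.det)⁻¹, g0))) (h1.prodMk continuousAt_id)
  have hD0 : D g0.det * g0 = g0 := by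
    have : Function.update (1 : Fin d → ℝ) i0 1 = 1 := Function.update_eq_self i0 (1 : Fin d → ℝ)
    simp only [hD, hg0, inv_one]
    rw [this]
    exact (congrArg (· * g0) Matrix.diagonal_one).trans (Matrix.one_mul g0)
  have hnhds : {M : Matrix (Fin d) (Fin d) ℝ | M.det ≠ 0 ∧ D M.det * M ∈ U} ∈ nhds g0 := by
    have h1 : {M : Matrix (Fin d) (Fin d) ℝ | M.det ≠ 0} ∈ nhds g0 :=
      (isOpen_ne.preimage continuous_id.matrix_det).mem_nhds (by simp [hg0])
    have h2 : {M : Matrix (Fin d) (Fin d) ℝ | D M.det * M ∈ U} ∈ nhds g0 :=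
      hDc (hU.mem_nhds (by simp only [hD0]; exact h0))
    exact Filter.inter_mem h1 h2
  obtain ⟨W, hW, hWo, hgW⟩ := mem_nhds_iff.1 hnhds
  obtain ⟨Q, hQ⟩ := exists_rat_matrix W hWo ⟨g0, hgW⟩
  set q : Matrix (Fin d) (Fin d) ℝ := Q.map (Rat.cast : ℚ → ℝ) with hq
  have hqd : q.det ≠ 0 := (hW hQ).1
  have hqQ : ∀ X Y : Matrix (Fin d) (Fin d) ℚ, (X * Y).map (Rat.cast : ℚ → ℝ) =
      X.map (Rat.cast : ℚ → ℝ) * Y.map (Rat.cast : ℚ → ℝ) := fun X Y =>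
    Matrix.map_mul (f := Rat.castHom ℝ)
  have hQd : Q.det ≠ 0 := by
    intro h
    apply hqd
    have := (Rat.castHom ℝ).map_det Q
    rw [h] at this
    simpa using this.symm
  set S0 : Set (Matrix (Fin d) (Fin d) ℝ) := {X | ∃ p, LowTri p ∧ p.det ≠ 0 ∧
    ∃ γ : Matrix (Fin d) (Fin d) ℤ, γ.det = 1 ∧ X = p * g * zm γ * q⁻¹} with hS0
  have key : (1 : Matrix (Fin d) (Fin d) ℝ) ∈ closure S0 := by
    apply S3core _ isClosed_closure
    · intro p hp hpd M hM
      have hc : Continuous fun X : Matrix (Fin d) (Fin d) ℝ => p * X :=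
        continuous_const.matrix_mul continuous_id
      refine map_mem_closure hc hM ?_
      rintro X ⟨p', hp', hpd', γ, hγ, rfl⟩
      refine ⟨p * p', hp.mul hp', by rw [Matrix.det_mul]; exact mul_ne_zero hpd hpd', γ, hγ, ?_⟩
      simp only [Matrix.mul_assoc]
    · intro i j hij
      obtain ⟨N, hN, B, hB⟩ := clear_denoms (Q⁻¹ * Matrix.single i j 1 * Q)
      have hBz : zm B = (N : ℝ) • (q⁻¹ * Matrix.single i j 1 * q) := by
        have e1 : q⁻¹ = (Q⁻¹).map (Rat.cast : ℚ → ℝ) := by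
          apply Matrix.inv_eq_left_inv
          rw [hq, ← hqQ, Matrix.nonsing_inv_mul _ hQd.isUnit]
          simp
        have e2 : (Matrix.single i j 1 : Matrix (Fin d) (Fin d) ℝ) =
            (Matrix.single i j 1 : Matrix (Fin d) (Fin d) ℚ).map (Rat.cast : ℚ → ℝ) := by
          ext a b
          simp [Matrix.single_apply]
          split_ifs <;> simp
        rw [e1, e2, hq, ← hqQ, ← hqQ]
        ext a b
        have := hB a b
        simp only [Matrix.map_apply, Matrix.smul_apply, smul_eq_mul]
        exact_mod_cast this.symm
      refine ⟨N, by exact_mod_cast hN.ne', fun n M hM => ?_⟩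
      have hqu : IsUnit q.det := hqd.isUnit
      have hconj : zm (1 + (n : ℤ) • B) = q⁻¹ * Matrix.transvection i j ((N : ℝ) * n) * q := by
        have e1 : zm (1 + (n : ℤ) • B) = 1 + (n : ℝ) • zm B := by
          ext a b
          simp only [Matrix.map_apply, Matrix.add_apply, Matrix.smul_apply, Matrix.one_apply,
            smul_eq_mul]
          split_ifs <;> simp
        rw [e1, hBz, Matrix.transvection, Matrix.mul_add, Matrix.add_mul, Matrix.mul_one,
          Matrix.nonsing_inv_mul _ hqu]
        congr 1
        have : (Matrix.single i j ((N : ℝ) * n)) = ((n : ℝ) * N) • (Matrix.single i j (1:ℝ)) := by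
          rw [Matrix.smul_single]; simp [mul_comm]
        rw [this, smul_smul, Matrix.mul_smul, Matrix.smul_mul]
      have hc : Continuous fun X : Matrix (Fin d) (Fin d) ℝ => X * Matrix.transvection i j ((N : ℝ) * n) :=
        continuous_id.matrix_mul continuous_const
      refine map_mem_closure (f := fun X => X * Matrix.transvection i j ((N : ℝ) * n)) hc hM ?_
      rintro X ⟨p', hp', hpd', γ, hγ, rfl⟩
      refine ⟨p', hp', hpd', γ * (1 + (n : ℤ) • B), ?_, ?_⟩
      · rw [Matrix.det_mul, hγ, one_mul]
        have h1 := zm_det (1 + (n : ℤ) • B)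
        rw [hconj, Matrix.det_mul, Matrix.det_mul, Matrix.det_transvection_of_ne i j hij, mul_one,
          ← Matrix.det_mul, Matrix.nonsing_inv_mul _ hqu, Matrix.det_one] at h1
        exact_mod_cast h1.symm
      · rw [zm_mul, hconj]
        simp only [Matrix.mul_assoc, Matrix.mul_nonsing_inv _ hqu, Matrix.mul_one]
    · refine ⟨g * q⁻¹, subset_closure ⟨1, ?_, by simp, 1, by simp, ?_⟩, ?_⟩
      · exact fun i j h => Matrix.one_apply_ne h.ne
      · simp
      · rw [Matrix.det_mul, hg, one_mul, Matrix.det_nonsing_inv]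
        simpa using hqd
  have hopen : IsOpen {X : Matrix (Fin d) (Fin d) ℝ | X * q ∈ W} :=
    hWo.preimage (continuous_id.matrix_mul continuous_const)
  obtain ⟨X, hX, p, hp, hpd, γ, hγ, rfl⟩ := mem_closure_iff.1 key _ hopen
    (by show 1 * q ∈ W; rw [Matrix.one_mul]; exact hQ)
  have hX : p * g * zm γ ∈ W := by
    have h := hX
    simp only [Set.mem_ofPred_eq] at h
    rwa [Matrix.mul_assoc _ q⁻¹ q, Matrix.nonsing_inv_mul _ hqd.isUnit, Matrix.mul_one] at h
  have hdet : (p * g * zm γ).det = p.det := by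
    rw [Matrix.det_mul, Matrix.det_mul, hg, zm_det, hγ]; simp
  have h3 := (hW hX).2
  rw [hdet] at h3
  refine ⟨D p.det * p, (lowTri_diag _).mul hp, ?_, γ, hγ, by simpa only [Matrix.mul_assoc] using h3⟩
  rw [Matrix.det_mul, hD]
  simp only [Matrix.det_diagonal]
  rw [Finset.prod_update_of_mem (Finset.mem_univ i0)]
  simp [hpd]

end FLproof

namespace FLproof

/-- Minkowski for boxes. -/
lemma minkowski_box {d : ℕ} (g : Matrix (Fin d) (Fin d) ℝ) (hg : g.det = 1) (r : Fin d → ℝ)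
    (hr : ∀ i, 0 < r i) (h1 : 1 < ∏ i, r i) :
    ∃ m : Fin d → ℤ, m ≠ 0 ∧ ∀ i, |g.mulVec (zv m) i| < r i := by
  set b := Pi.basisFun ℝ (Fin d)
  have fund := ZSpan.isAddFundamentalDomain' b MeasureTheory.volume
  set f := Matrix.toLin' g with hf
  have hfd : LinearMap.det f = 1 := by rw [hf, LinearMap.det_toLin', hg]
  set K : Set (Fin d → ℝ) := Set.pi Set.univ fun i => Set.Ioo (- r i) (r i) with hK
  have hKc : Convex ℝ K := convex_pi fun i _ => convex_Ioo _ _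
  have hvol : MeasureTheory.volume (f ⁻¹' K) = ENNReal.ofReal (∏ i, (2 * r i)) := by
    rw [MeasureTheory.Measure.addHaar_preimage_linearMap _ (by rw [hfd]; norm_num), hfd, hK,
      Real.volume_pi_Ioo, ENNReal.ofReal_prod_of_nonneg]
    · simp only [inv_one, abs_one, ENNReal.ofReal_one, one_mul]
      apply Finset.prod_congr rfl; intro i _; congr 1; ring
    · intro i _; have := hr i; positivity
  have hF : MeasureTheory.volume (ZSpan.fundamentalDomain b) = 1 := by
    rw [ZSpan.fundamentalDomain_pi_basisFun, Real.volume_pi_Ico]; simp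
  have : Countable (Submodule.span ℤ (Set.range b)).toAddSubgroup :=
    inferInstanceAs (Countable (Submodule.span ℤ (Set.range b)))
  obtain ⟨x, hx0, hx⟩ := MeasureTheory.exists_ne_zero_mem_lattice_of_measure_mul_two_pow_lt_measure
    (s := f ⁻¹' K) fund
    (by
      intro x hx
      simp only [hK, Set.mem_preimage, Set.mem_univ_pi, Set.mem_Ioo, map_neg, Pi.neg_apply] at hx ⊢
      intro i; have := hx i; constructor <;> linarith)
    (hKc.linear_preimage f)
    (by
      rw [hF, hvol, one_mul, Module.finrank_fin_fun, Finset.prod_mul_distrib]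
      simp only [Finset.prod_const, Finset.card_univ, Fintype.card_fin]
      rw [← ENNReal.ofReal_ofNat, ← ENNReal.ofReal_pow (by norm_num)]
      apply (ENNReal.ofReal_lt_ofReal_iff (by positivity)).2
      have : (0:ℝ) < 2 ^ d := by positivity
      nlinarith)
  have hxm : ((x : Fin d → ℝ)) ∈ Submodule.span ℤ (Set.range b) := x.2
  rw [Module.Basis.mem_span_iff_repr_mem] at hxm
  choose m hm using hxm
  have hxz : (x : Fin d → ℝ) = zv m := by
    ext i
    have := hm i
    simpa [b] using this.symm
  refine ⟨m, ?_, ?_⟩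
  · rintro rfl
    apply hx0
    ext i
    simp [hxz]
  · intro i
    have := (Set.mem_univ_pi.1 hx) i
    rw [hxz, hf, Matrix.toLin'_apply] at this
    exact abs_lt.2 this

lemma short_basis {d : ℕ} (hd : 0 < d) (δ : ℝ) (hδ : 0 < δ) : ∃ R : ℝ, 0 < R ∧
    ∀ g : Matrix (Fin d) (Fin d) ℝ, g.det = 1 →
      (∀ m : Fin d → ℤ, m ≠ 0 → ∃ i, δ ≤ |g.mulVec (zv m) i|) →
      ∃ M : Matrix (Fin d) (Fin d) ℤ, M.det ≠ 0 ∧ ∀ i j, |(g * zm M) i j| ≤ R := by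
  have hd' : (0:ℝ) < d := by exact_mod_cast hd
  set δ' := δ / d with hδ'
  have hδ'0 : 0 < δ' := by positivity
  set R := δ' + 2 / δ' ^ (d - 1) with hR
  have hR0 : 0 < R := by positivity
  refine ⟨R, hR0, fun g hg hshort => ?_⟩
  have hRv : 1 < δ' ^ (d - 1) * R := by
    rw [hR, mul_add]
    have h1 : δ' ^ (d - 1) * (2 / δ' ^ (d - 1)) = 2 := by field_simp
    have h2 : 0 < δ' ^ (d - 1) * δ' := by positivity
    linarith
  set A : Set (Fin d → ℝ) := {w | ∃ m : Fin d → ℤ, w = zv m ∧ ∀ i, |g.mulVec (zv m) i| ≤ R} with hA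
  have hspan : Submodule.span ℝ A = ⊤ := by
    by_contra hne
    obtain ⟨φ, hφ0, hφ⟩ := Submodule.exists_le_ker_of_lt_top (Submodule.span ℝ A) (lt_top_iff_ne_top.2 hne)
    -- functional on g-coordinates
    set ψ : (Fin d → ℝ) →ₗ[ℝ] ℝ := φ ∘ₗ Matrix.toLin' g⁻¹ with hψ
    have hgu : IsUnit g.det := by rw [hg]; exact isUnit_one
    have hψφ : ∀ w, ψ (g.mulVec w) = φ w := by
      intro w
      simp [hψ, Matrix.nonsing_inv_mul _ hgu]
    set c : Fin d → ℝ := fun i => ψ (Pi.single i 1) with hc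
    have hψc : ∀ w, ψ w = ∑ i, w i * c i := by
      intro w
      rw [LinearMap.pi_apply_eq_sum_univ ψ w]
      apply Finset.sum_congr rfl
      intro i _
      rw [smul_eq_mul, hc]
      congr 2
      ext j
      simp [Pi.single_apply, eq_comm]
    have : Nonempty (Fin d) := ⟨⟨0, hd⟩⟩
    obtain ⟨i0, hi0⟩ := Finite.exists_max fun i => |c i|
    have hci0 : 0 < |c i0| := by
      by_contra hneg
      apply hφ0
      ext w
      have hz : ∀ i, c i = 0 := fun i => abs_nonpos_iff.1 ((hi0 i).trans (not_lt.1 hneg))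
      have := hψφ (Pi.single w 1)
      rw [hψc] at this
      simp [hz] at this
      simp [← this]
    obtain ⟨m, hm0, hm⟩ := minkowski_box g hg (Function.update (fun _ => δ') i0 R)
      (by intro i; by_cases h : i = i0
          · subst h; simpa using hR0
          · simpa [h] using hδ'0)
      (by
        rw [Finset.prod_update_of_mem (Finset.mem_univ i0)]
        simp only [Finset.prod_const]
        rw [mul_comm]
        have hcard : (Finset.univ \ {i0}).card = d - 1 := by
          rw [Finset.card_sdiff_of_subset (Finset.subset_univ _)]; simp
        rw [hcard]; exact hRv)
    have hother : ∀ i, i ≠ i0 → |g.mulVec (zv m) i| < δ' := by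
      intro i hi
      have := hm i
      rwa [Function.update_of_ne hi] at this
    have hi0R : |g.mulVec (zv m) i0| < R := by
      have := hm i0
      rwa [Function.update_self] at this
    have hmA : zv m ∈ A := by
      refine ⟨m, rfl, fun i => ?_⟩
      by_cases h : i = i0
      · subst h; exact hi0R.le
      · refine (hother i h).le.trans ?_
        have : 0 < 2 / δ' ^ (d - 1) := by positivity
        rw [hR]; linarith
    have hker : ψ (g.mulVec (zv m)) = 0 := by
      rw [hψφ]; exact hφ (Submodule.subset_span hmA)
    rw [hψc, ← Finset.add_sum_erase _ _ (Finset.mem_univ i0)] at hker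
    have hb : |g.mulVec (zv m) i0| * |c i0| ≤ (d - 1) * δ' * |c i0| := by
      rw [← abs_mul, eq_neg_of_add_eq_zero_left hker, abs_neg]
      refine (Finset.abs_sum_le_sum_abs _ _).trans ?_
      have : ∀ i ∈ Finset.univ.erase i0, |g.mulVec (zv m) i * c i| ≤ δ' * |c i0| := by
        intro i hi
        rw [abs_mul]
        exact mul_le_mul (hother i (Finset.ne_of_mem_erase hi)).le (hi0 i) (abs_nonneg _) hδ'0.le
      refine (Finset.sum_le_sum this).trans ?_
      rw [Finset.sum_const, Finset.card_erase_of_mem (Finset.mem_univ _), nsmul_eq_mul]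
      simp only [Finset.card_univ, Fintype.card_fin]
      rw [Nat.cast_sub (by omega), mul_assoc]
      simp
    have hb2 : |g.mulVec (zv m) i0| ≤ (d - 1) * δ' := le_of_mul_le_mul_right hb hci0
    have hdδ : (d : ℝ) * δ' = δ := by rw [hδ']; field_simp
    obtain ⟨i, hi⟩ := hshort m hm0
    by_cases h : i = i0
    · subst h; linarith
    · have := hother i h
      have h1 : (1:ℝ) ≤ d := by exact_mod_cast hd
      nlinarith
  obtain ⟨f, hfA, -, hfl⟩ := Submodule.exists_fun_fin_finrank_span_eq ℝ A
  have hfr : Module.finrank ℝ (Submodule.span ℝ A) = d := by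
    rw [hspan, finrank_top, Module.finrank_fin_fun]
  set e : Fin d ≃ Fin (Module.finrank ℝ (Submodule.span ℝ A)) := finCongr hfr.symm
  choose m hm hmR using hfA
  set M : Matrix (Fin d) (Fin d) ℤ := fun i j => m (e j) i with hM
  have hcol : (zm M).transpose = fun j => f (e j) := by
    ext j i
    rw [hm]
    rfl
  refine ⟨M, ?_, ?_⟩
  · have h1 : LinearIndependent ℝ (fun j => f (e j)) := hfl.comp e e.injective
    have h2 := (Matrix.linearIndependent_rows_iff_isUnit (A := (zm M).transpose)).1 (by
      have : (zm M).transpose.row = fun j => f (e j) := hcol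
      rw [this]; exact h1)
    rw [Matrix.isUnit_iff_isUnit_det, Matrix.det_transpose, zm_det] at h2
    intro h0
    rw [h0] at h2
    simp at h2
  · intro i j
    have h1 : (g * zm M) i j = g.mulVec (zv (m (e j))) i := rfl
    rw [h1]
    exact hmR (e j) i

theorem mahler {d : ℕ} (hd : 0 < d) (δ : ℝ) (hδ : 0 < δ) (g : ℕ → Matrix (Fin d) (Fin d) ℝ)
    (hg : ∀ n, (g n).det = 1)
    (hshort : ∀ n, ∀ m : Fin d → ℤ, m ≠ 0 → ∃ i, δ ≤ |(g n).mulVec (zv m) i|) :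
    ∃ (γ : ℕ → Matrix (Fin d) (Fin d) ℤ) (φ : ℕ → ℕ) (gs : Matrix (Fin d) (Fin d) ℝ),
      StrictMono φ ∧ (∀ k, (γ k).det = 1) ∧
      Filter.Tendsto (fun k => g (φ k) * zm (γ k)) Filter.atTop (nhds gs) := by
  obtain ⟨R, hR, hbas⟩ := short_basis hd δ hδ
  choose M hM0 hMR using fun n => hbas (g n) (hg n) (hshort n)
  obtain ⟨D, hD⟩ := exists_nat_gt ((Nat.factorial (Fintype.card (Fin d))) • R ^ Fintype.card (Fin d))
  have hdetb : ∀ n, (M n).det ∈ Set.Icc (-(D:ℤ)) D := by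
    intro n
    have h1 := Matrix.det_le (A := g n * zm (M n)) (abv := AbsoluteValue.abs) (x := R) (hMR n)
    rw [Matrix.det_mul, hg, one_mul, zm_det] at h1
    have h2 : |((M n).det : ℝ)| ≤ D := h1.trans hD.le
    have h3 : |(M n).det| ≤ (D : ℤ) := by exact_mod_cast h2
    exact abs_le.1 h3
  -- first pigeonhole
  let F1 : ℕ → Set.Icc (-(D:ℤ)) D := fun n => ⟨(M n).det, hdetb n⟩
  obtain ⟨⟨q, hqm⟩, hq⟩ := Finite.exists_infinite_fiber F1
  have hq0 : q ≠ 0 := by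
    obtain ⟨⟨n, hn⟩⟩ := hq.nonempty
    have : (M n).det = q := congrArg Subtype.val hn
    rw [← this]; exact hM0 n
  have : NeZero q.natAbs := ⟨by simpa using hq0⟩
  let F2 : (F1 ⁻¹' {⟨q, hqm⟩} : Set ℕ) → Fin d → Fin d → ZMod q.natAbs :=
    fun n i j => ((M n.1 i j : ℤ) : ZMod q.natAbs)
  obtain ⟨y, hy⟩ := Finite.exists_infinite_fiber F2
  set T : Set ℕ := {n | (M n).det = q ∧ ∀ i j, ((M n i j : ℤ) : ZMod q.natAbs) = y i j} with hT
  have hTinf : T.Infinite := by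
    refine Set.infinite_of_injective_forall_mem (f := fun z : (F2 ⁻¹' {y} : Set _) => (z.1.1 : ℕ)) ?_ ?_
    · intro z w h
      exact Subtype.ext (Subtype.ext h)
    · rintro ⟨⟨n, hn⟩, hn'⟩
      refine ⟨congrArg Subtype.val hn, fun i j => ?_⟩
      exact congrFun (congrFun hn' i) j
  set ψ : ℕ → ℕ := Nat.nth (· ∈ T) with hψ
  have hψm : StrictMono ψ := Nat.nth_strictMono hTinf
  have hψT : ∀ k, ψ k ∈ T := fun k => Nat.nth_mem_of_infinite hTinf k
  set M0 := M (ψ 0) with hM0def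
  have hMd : ∀ k, ∃ B : Matrix (Fin d) (Fin d) ℤ, M (ψ k) = M0 + q • B := by
    intro k
    have : ∀ i j, ∃ b : ℤ, M (ψ k) i j = M0 i j + q * b := by
      intro i j
      have h1 : ((M0 i j : ℤ) : ZMod q.natAbs) = (M (ψ k) i j : ℤ) := by
        rw [(hψT k).2, hM0def, (hψT 0).2]
      have h2 := (ZMod.intCast_eq_intCast_iff_dvd_sub _ _ _).1 h1
      rw [Int.natAbs_dvd] at h2
      obtain ⟨b, hb⟩ := h2
      exact ⟨b, by linarith⟩
    choose B hB using this
    refine ⟨B, ?_⟩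
    ext i j
    rw [hB]; rfl
  choose B hB using hMd
  set γ : ℕ → Matrix (Fin d) (Fin d) ℤ := fun k => 1 + B k * M0.adjugate with hγ
  have hγM : ∀ k, γ k * M0 = M (ψ k) := by
    intro k
    rw [hγ]
    simp only
    rw [Matrix.add_mul, Matrix.one_mul, Matrix.mul_assoc, Matrix.adjugate_mul, (hψT 0).1,
      hB k, Matrix.mul_smul, Matrix.mul_one]
  have hγd : ∀ k, (γ k).det = 1 := by
    intro k
    have := congrArg Matrix.det (hγM k)
    rw [Matrix.det_mul, (hψT k).1, hM0def, (hψT 0).1] at this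
    exact mul_right_cancel₀ hq0 (this.trans (one_mul q).symm)
  obtain ⟨H, φ, hφ, hH⟩ := mat_subseq (fun k => g (ψ k) * zm (M (ψ k))) R (fun k => hMR (ψ k))
  refine ⟨fun k => γ (φ k), fun k => ψ (φ k), H * (zm M0)⁻¹, hψm.comp hφ, fun k => hγd _, ?_⟩
  have hM0u : IsUnit (zm M0).det := by
    rw [zm_det, hM0def, (hψT 0).1]
    simpa using hq0
  have heq : (fun k => g (ψ (φ k)) * zm (γ (φ k))) = fun k => (g (ψ (φ k)) * zm (M (ψ (φ k)))) * (zm M0)⁻¹ := by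
    ext1 k
    rw [← hγM, zm_mul]
    simp only [Matrix.mul_assoc, Matrix.mul_nonsing_inv _ hM0u, Matrix.mul_one]
  rw [heq]
  have hc : Continuous fun X : Matrix (Fin d) (Fin d) ℝ => X * (zm M0)⁻¹ :=
    continuous_id.matrix_mul continuous_const
  exact (hc.tendsto H).comp hH

end FLproof

namespace FLproof

open MeasureTheory in
lemma vol_slab {n : ℕ} (v : Fin n → ℝ) (w0 : ℝ) (hw : w0 ≠ 0) (r : Fin n → ℝ) (hr : ∀ i, 0 < r i) :
    volume {s : Fin n → ℝ | ∀ i, |v i + s i * w0| < r i} ≤ ENNReal.ofReal (∏ i, (2 * (r i / |w0|))) := by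
  have hsub : {s : Fin n → ℝ | ∀ i, |v i + s i * w0| < r i} ⊆
      Set.pi Set.univ fun i => Metric.ball (-(v i) / w0) (r i / |w0|) := by
    intro s hs
    rw [Set.mem_univ_pi]
    intro i
    have h1 : |v i + s i * w0| < r i := hs i
    rw [Metric.mem_ball, Real.dist_eq, lt_div_iff₀ (abs_pos.2 hw), ← abs_mul]
    have : (s i - -(v i) / w0) * w0 = v i + s i * w0 := by field_simp; ring
    rwa [this]
  refine (measure_mono hsub).trans ?_
  rw [volume_pi_pi, ENNReal.ofReal_prod_of_nonneg]
  · simp only [Real.volume_ball]; rfl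
  · intro i _
    have := hr i
    positivity

/-- counting function -/
lemma floor_facts (x : ℝ) (hx : 1 ≤ |x|) : (⌊x⌋ ≠ 0) ∧ |(⌊x⌋ : ℝ)| ≤ 2 * |x| ∧ |x| ≤ |(⌊x⌋ : ℝ)| + 1 ∧
    |(⌊x⌋ : ℝ)| / 2 ≤ |x| := by
  have h1 := Int.floor_le x
  have h2 := Int.lt_floor_add_one x
  rcases le_abs.1 hx with h | h
  · have h3 : (1 : ℤ) ≤ ⌊x⌋ := Int.le_floor.2 (by simpa using h)
    have h3' : (1 : ℝ) ≤ ⌊x⌋ := by exact_mod_cast h3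
    refine ⟨by omega, ?_⟩
    rw [abs_of_pos (by linarith : (0:ℝ) < ⌊x⌋), abs_of_pos (by linarith : 0 < x)]
    refine ⟨by linarith, by linarith, by linarith⟩
  · have h3 : ⌊x⌋ ≤ -1 := by
      have : ⌊x⌋ < 0 := Int.floor_lt.2 (by simp; linarith)
      omega
    have h3' : (⌊x⌋ : ℝ) ≤ -1 := by exact_mod_cast h3
    refine ⟨by omega, ?_⟩
    rw [abs_of_neg (by linarith : (⌊x⌋:ℝ) < 0), abs_of_neg (by linarith : x < 0)]
    refine ⟨by linarith, by linarith, by linarith⟩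

open MeasureTheory in
lemma S1count (n : ℕ) (K P : ℝ) (hK : 0 < K) (hP : 0 ≤ P) :
    ∑' p : ℤ × (Fin n → ℤ), (if p.1 ≠ 0 ∧ |(p.1 : ℝ)| ≤ K ∧ ∀ i, |p.2 i| ≤ 5 * |p.1| then
      ENNReal.ofReal ((P / |(p.1:ℝ)|) ^ n) else 0) ≤ ENNReal.ofReal (2 * K * (11 * P) ^ n) := by
  classical
  rw [ENNReal.tsum_prod']
  have hin : ∀ j : ℤ, ∑' z : Fin n → ℤ, (if j ≠ 0 ∧ |(j : ℝ)| ≤ K ∧ ∀ i, |z i| ≤ 5 * |j| then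
      ENNReal.ofReal ((P / |(j:ℝ)|) ^ n) else 0) ≤
      if j ∈ (Finset.Icc (-⌊K⌋) ⌊K⌋).erase 0 then ENNReal.ofReal ((11 * P) ^ n) else 0 := by
    intro j
    by_cases hj : j ≠ 0 ∧ |(j : ℝ)| ≤ K
    · have hmem : j ∈ (Finset.Icc (-⌊K⌋) ⌊K⌋).erase 0 := by
        rw [Finset.mem_erase, Finset.mem_Icc, ← abs_le]
        exact ⟨hj.1, Int.le_floor.2 (by simpa using hj.2)⟩
      rw [if_pos hmem]
      have hjp : (0:ℝ) < |(j:ℝ)| := by simpa using hj.1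
      have hj1 : (1:ℝ) ≤ |(j:ℝ)| := by
        have : (1:ℤ) ≤ |j| := Int.one_le_abs hj.1
        exact_mod_cast this
      rw [tsum_eq_sum (s := Fintype.piFinset fun _ : Fin n => Finset.Icc (-(5 * |j|)) (5 * |j|))]
      · calc _ ≤ ∑ z ∈ Fintype.piFinset fun _ : Fin n => Finset.Icc (-(5 * |j|)) (5 * |j|),
              ENNReal.ofReal ((P / |(j:ℝ)|) ^ n) := by
              apply Finset.sum_le_sum
              intro z _
              split_ifs
              · exact le_rfl
              · exact zero_le
          _ = ENNReal.ofReal (((10 * |(j:ℝ)| + 1)) ^ n * (P / |(j:ℝ)|) ^ n) := by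
              rw [Finset.sum_const, Fintype.card_piFinset, nsmul_eq_mul, ENNReal.ofReal_mul (by positivity)]
              congr 1
              simp only [Int.card_Icc, Finset.prod_const, Finset.card_univ, Fintype.card_fin]
              rw [ENNReal.ofReal_pow (by positivity)]
              push_cast
              congr 1
              rw [← ENNReal.ofReal_natCast]
              congr 1
              have : (((5 * |j| + 1 - -(5 * |j|)).toNat : ℤ)) = 10 * |j| + 1 := by
                rw [Int.toNat_of_nonneg (by have := abs_nonneg j; linarith)]; ring
              have h2 : (((5 * |j| + 1 - -(5 * |j|)).toNat : ℤ) : ℝ) = ((10 * |j| + 1 : ℤ) : ℝ) := by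
                rw [this]
              push_cast at h2
              exact h2
          _ ≤ _ := by
              apply ENNReal.ofReal_le_ofReal
              rw [← mul_pow]
              apply pow_le_pow_left₀ (by positivity)
              rw [← mul_div_assoc, div_le_iff₀ hjp]
              nlinarith
      · intro z hz
        rw [if_neg]
        rintro ⟨-, -, h⟩
        apply hz
        rw [Fintype.mem_piFinset]
        intro i
        rw [Finset.mem_Icc, ← abs_le]
        exact h i
    · have : ∀ z : Fin n → ℤ, (if j ≠ 0 ∧ |(j : ℝ)| ≤ K ∧ ∀ i, |z i| ≤ 5 * |j| then
          ENNReal.ofReal ((P / |(j:ℝ)|) ^ n) else 0) = 0 := by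
        intro z
        rw [if_neg]
        rintro ⟨h1, h2, -⟩
        exact hj ⟨h1, h2⟩
      simp only [this, tsum_zero]
      exact zero_le
  refine (ENNReal.tsum_le_tsum hin).trans ?_
  rw [tsum_eq_sum (s := (Finset.Icc (-⌊K⌋) ⌊K⌋).erase 0)]
  · rw [Finset.sum_ite_mem, Finset.inter_self, Finset.sum_const, nsmul_eq_mul, ENNReal.ofReal_mul (by positivity)]
    gcongr
    rw [← ENNReal.ofReal_natCast]
    apply ENNReal.ofReal_le_ofReal
    have hf : (0:ℤ) ≤ ⌊K⌋ := Int.floor_nonneg.2 hK.le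
    rw [Finset.card_erase_of_mem (by rw [Finset.mem_Icc]; omega), Int.card_Icc]
    have h1 : (((⌊K⌋ + 1 - -⌊K⌋).toNat - 1 : ℕ) : ℤ) = 2 * ⌊K⌋ := by omega
    have h2 : ((((⌊K⌋ + 1 - -⌊K⌋).toNat - 1 : ℕ) : ℤ) : ℝ) = ((2 * ⌊K⌋ : ℤ) : ℝ) := by rw [h1]
    rw [Int.cast_natCast] at h2
    rw [h2]
    push_cast
    have := Int.floor_le K
    linarith
  · intro j hj
    rw [if_neg hj]

open MeasureTheory in
theorem S1core (n : ℕ) (c δ : ℝ) (hc : 0 < c) (hδ : 0 < δ) (hδc : 2 * δ ≤ c) (b : Fin n → ℝ)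
    (hb : ∀ i, 1 ≤ b i) (g : Matrix (Fin (n+1)) (Fin (n+1)) ℝ)
    (hg : ∀ m : Fin (n+1) → ℤ, m ≠ 0 → ∃ i, c ≤ |g.mulVec (zv m) i|) :
    volume {s : Fin n → ℝ | (∀ i, s i ∈ Set.Icc (0:ℝ) 1) ∧ ∃ m : Fin (n+1) → ℤ, m ≠ 0 ∧
      |g.mulVec (zv m) 0| < δ * ∏ i, b i ∧
      ∀ i : Fin n, |g.mulVec (zv m) i.succ + s i * g.mulVec (zv m) 0| < δ / b i} ≤
      ENNReal.ofReal ((88 * δ / c) ^ (n+1)) := by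
  set T := ∏ i, b i with hT
  have hb0 : ∀ i, 0 < b i := fun i => lt_of_lt_of_le one_pos (hb i)
  have hT0 : 0 < T := Finset.prod_pos fun i _ => hb0 i
  set L := 2 / c with hL
  have hL0 : 0 < L := by positivity
  have hLc : L * c = 2 := by rw [hL]; field_simp
  set B : (Fin (n+1) → ℤ) → Set (Fin n → ℝ) := fun m => {s | (∀ i, s i ∈ Set.Icc (0:ℝ) 1) ∧ m ≠ 0 ∧
      |g.mulVec (zv m) 0| < δ * T ∧
      ∀ i : Fin n, |g.mulVec (zv m) i.succ + s i * g.mulVec (zv m) 0| < δ / b i} with hB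
  set Φ : (Fin (n+1) → ℤ) → ℤ × (Fin n → ℤ) := fun m =>
    (⌊L * g.mulVec (zv m) 0⌋, fun i => ⌊L * g.mulVec (zv m) i.succ⌋) with hΦ
  have hinj : Function.Injective Φ := by
    intro m m' h
    by_contra hne
    obtain ⟨i, hi⟩ := hg (m - m') (sub_ne_zero.2 hne)
    have hz : zv (m - m') = zv m - zv m' := by ext; simp [zv]
    rw [hz, Matrix.mulVec_sub, Pi.sub_apply] at hi
    have hfl : ⌊L * g.mulVec (zv m) i⌋ = ⌊L * g.mulVec (zv m') i⌋ := by
      refine Fin.cases ?_ (fun i => ?_) i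
      · exact congrArg Prod.fst h
      · exact congrFun (congrArg Prod.snd h) i
    have h1 := Int.abs_sub_lt_one_of_floor_eq_floor hfl
    rw [← mul_sub, abs_mul, abs_of_pos hL0] at h1
    nlinarith
  set F : ℤ × (Fin n → ℤ) → ENNReal := fun p => if p.1 ≠ 0 ∧ |(p.1 : ℝ)| ≤ 2 * L * δ * T ∧ ∀ i, |p.2 i| ≤ 5 * |p.1| then
      ENNReal.ofReal ((4 * L * δ / |(p.1:ℝ)|) ^ n) else 0 with hF
  have hBm : ∀ m, volume (B m) ≤ F (Φ m) * ENNReal.ofReal (1 / T) := by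
    intro m
    rcases (B m).eq_empty_or_nonempty with he | ⟨s, hs, hm0, hw0, hws⟩
    · rw [he]; simp
    set w := g.mulVec (zv m) with hw
    have hwi : ∀ i, |w i| ≤ |w 0| + δ := by
      intro i
      refine Fin.cases (by linarith) (fun i => ?_) i
      have h1 := hws i
      have h2 : δ / b i ≤ δ := div_le_self hδ.le (hb i)
      have h3 : |s i * w 0| ≤ |w 0| := by
        rw [abs_mul, abs_of_nonneg (hs i).1]
        exact mul_le_of_le_one_left (abs_nonneg _) (hs i).2
      have h4 : |w i.succ| ≤ |w i.succ + s i * w 0| + |s i * w 0| := by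
        have := abs_sub (w i.succ + s i * w 0) (s i * w 0)
        simpa using this
      linarith
    have hw0c : c / 2 ≤ |w 0| := by
      obtain ⟨i, hi⟩ := hg m hm0
      have := hwi i
      linarith
    have hw0p : 0 < |w 0| := by linarith
    have hLw : 1 ≤ |L * w 0| := by
      rw [abs_mul, abs_of_pos hL0]; nlinarith
    obtain ⟨f1, f2, f3, f4⟩ := floor_facts _ hLw
    set z : ℤ := ⌊L * w 0⌋ with hz
    have hz1 : (1:ℝ) ≤ |(z:ℝ)| := by
      have : (1:ℤ) ≤ |z| := Int.one_le_abs f1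
      exact_mod_cast this
    have hLw' : |L * w 0| = L * |w 0| := by rw [abs_mul, abs_of_pos hL0]
    rw [hLw'] at f2 f3 f4
    have hFv : F (Φ m) = ENNReal.ofReal ((4 * L * δ / |(z:ℝ)|) ^ n) := by
      rw [hF]
      simp only
      rw [if_pos]
      refine ⟨f1, ?_, ?_⟩
      · change |(z:ℝ)| ≤ _
        nlinarith
      · intro i
        change |⌊L * w i.succ⌋| ≤ 5 * |z|
        have h1 := Int.floor_le (L * w i.succ)
        have h2 := Int.lt_floor_add_one (L * w i.succ)
        have h3 : |L * w i.succ| ≤ 2 * (L * |w 0|) := by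
          rw [abs_mul, abs_of_pos hL0]
          have := hwi i.succ
          nlinarith
        have h4 := abs_le.1 h3
        have : |(⌊L * w i.succ⌋ : ℝ)| ≤ 5 * |(z:ℝ)| := by
          rw [abs_le]; constructor <;> linarith
        exact_mod_cast this
    rw [hFv, ← ENNReal.ofReal_mul (by positivity)]
    have hsub : B m ⊆ {s : Fin n → ℝ | ∀ i, |w i.succ + s i * w 0| < δ / b i} := fun s hs => hs.2.2.2
    refine (measure_mono hsub).trans ((vol_slab _ _ (abs_pos.1 hw0p) _ (fun i => div_pos hδ (hb0 i))).trans ?_)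
    apply ENNReal.ofReal_le_ofReal
    have e1 : ∏ i, (2 * (δ / b i / |w 0|)) = (2 * δ / |w 0|) ^ n * (1 / T) := by
      have : ∀ i, 2 * (δ / b i / |w 0|) = (2 * δ / |w 0|) * (b i)⁻¹ := by
        intro i; have := hb0 i; field_simp
      simp only [this]
      rw [Finset.prod_mul_distrib, Finset.prod_const, Finset.card_univ, Fintype.card_fin, hT,
        Finset.prod_inv_distrib, one_div]
    rw [e1]
    have : 2 * δ / |w 0| ≤ 4 * L * δ / |(z:ℝ)| := by
      rw [div_le_div_iff₀ hw0p (by linarith)]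
      nlinarith
    gcongr
  have hsub : {s : Fin n → ℝ | (∀ i, s i ∈ Set.Icc (0:ℝ) 1) ∧ ∃ m : Fin (n+1) → ℤ, m ≠ 0 ∧
      |g.mulVec (zv m) 0| < δ * ∏ i, b i ∧
      ∀ i : Fin n, |g.mulVec (zv m) i.succ + s i * g.mulVec (zv m) 0| < δ / b i} ⊆ ⋃ m, B m := by
    rintro s ⟨h1, m, h2, h3, h4⟩
    exact Set.mem_iUnion.2 ⟨m, h1, h2, h3, h4⟩
  refine (measure_mono hsub).trans ((measure_iUnion_le _).trans ((ENNReal.tsum_le_tsum hBm).trans ?_))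
  rw [ENNReal.tsum_mul_right]
  have hK : 0 < 2 * L * δ * T := by positivity
  have hcnt := S1count n (2 * L * δ * T) (4 * L * δ) hK (by positivity)
  refine (mul_le_mul_left ((ENNReal.tsum_comp_le_tsum_of_injective hinj F).trans hcnt) _).trans ?_
  rw [← ENNReal.ofReal_mul (by positivity)]
  apply ENNReal.ofReal_le_ofReal
  have e : 2 * (2 * L * δ * T) * (11 * (4 * L * δ)) ^ n * (1 / T) = (4 * L * δ) * (44 * L * δ) ^ n := by
    have : 11 * (4 * L * δ) = 44 * L * δ := by ring
    rw [this]; field_simp; ring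
  have e2 : 88 * δ / c = 44 * L * δ := by rw [hL]; ring
  rw [e, e2, pow_succ, mul_comm]
  have : 0 < L * δ := by positivity
  gcongr
  linarith

end FLproof

namespace FLproof
open MeasureTheory

lemma isEmb (d : ℕ) : Topology.IsClosedEmbedding (fun g : SLd d => (g : Matrix (Fin d) (Fin d) ℝ)) := by
  refine ⟨⟨⟨rfl⟩, Subtype.val_injective⟩, ?_⟩
  have : Set.range (fun g : SLd d => (g : Matrix (Fin d) (Fin d) ℝ)) = {A | A.det = 1} := by
    ext A; constructor
    · rintro ⟨g, rfl⟩; exact g.2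
    · intro h; exact ⟨⟨A, h⟩, rfl⟩
  rw [this]
  exact isClosed_eq (Continuous.matrix_det continuous_id) continuous_const

instance instTG (d : ℕ) : IsTopologicalGroup (SLd d) := Matrix.SpecialLinearGroup.topologicalGroup
instance instBS (d : ℕ) : BorelSpace (SLd d) := ⟨rfl⟩
instance instMLC (d : ℕ) : LocallyCompactSpace (Matrix (Fin d) (Fin d) ℝ) :=
  inferInstanceAs (LocallyCompactSpace (Fin d → Fin d → ℝ))
instance instMSC (d : ℕ) : SecondCountableTopology (Matrix (Fin d) (Fin d) ℝ) :=
  inferInstanceAs (SecondCountableTopology (Fin d → Fin d → ℝ))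
instance instLC (d : ℕ) : LocallyCompactSpace (SLd d) := (isEmb d).locallyCompactSpace
instance instSC (d : ℕ) : SecondCountableTopology (SLd d) :=
  (isEmb d).isEmbedding.secondCountableTopology
instance instT2 (d : ℕ) : T2Space (SLd d) := (isEmb d).isEmbedding.t2Space

lemma cont_coe (d : ℕ) : Continuous (fun g : SLd d => (g : Matrix (Fin d) (Fin d) ℝ)) :=
  (isEmb d).continuous

lemma cont_entry {d : ℕ} (i j : Fin d) : Continuous (fun g : SLd d => (g : Matrix (Fin d) (Fin d) ℝ) i j) :=
  (cont_coe d).matrix_elem i j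

noncomputable def alp (n : ℕ) : Fin (n+1) → ℝ :=
  Fin.cons (∏ i : Fin n, ((i : ℝ) + 2))⁻¹ (fun i : Fin n => (i : ℝ) + 2)

lemma alp_pos (n : ℕ) (i) : 0 < alp n i := by
  refine Fin.cases ?_ (fun i => ?_) i
  · simp only [alp, Fin.cons_zero]
    exact inv_pos.2 (Finset.prod_pos fun i _ => by positivity)
  · simp only [alp, Fin.cons_succ]; positivity

lemma alp_prod (n : ℕ) : ∏ i, alp n i = 1 := by
  rw [Fin.prod_univ_succ]
  simp only [alp, Fin.cons_zero, Fin.cons_succ]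
  exact inv_mul_cancel₀ (Finset.prod_pos fun i _ => by positivity).ne'

lemma alp_lt (n : ℕ) (i j : Fin (n+1)) (h : i < j) : alp n i < alp n j := by
  induction j using Fin.cases with
  | zero => exact absurd h (Fin.not_lt_zero i)
  | succ j =>
    induction i using Fin.cases with
    | zero =>
      simp only [alp, Fin.cons_zero, Fin.cons_succ]
      have h1 : (1:ℝ) ≤ ∏ i : Fin n, ((i : ℝ) + 2) := by
        rw [← Finset.prod_const_one (ι := Fin n) (s := Finset.univ)]
        apply Finset.prod_le_prod (fun _ _ => zero_le_one)
        intro i _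
        have : (0:ℝ) ≤ (i : ℝ) := by positivity
        linarith
      have h2 := inv_le_one_of_one_le₀ h1
      have : (0:ℝ) ≤ (j : ℝ) := by positivity
      linarith
    | succ i =>
      simp only [alp, Fin.cons_succ]
      have : (i : ℕ) < j := by simpa using h
      have : (i : ℝ) < j := by exact_mod_cast this
      linarith

noncomputable def aSL (n k : ℕ) : SLd (n+1) :=
  ⟨Matrix.diagonal fun i => alp n i ^ k, by
    rw [Matrix.det_diagonal, Finset.prod_pow, alp_prod, one_pow]⟩

noncomputable def hSL {n : ℕ} (s : Fin n → ℝ) : SLd (n+1) :=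
  ⟨1 + Matrix.vecMulVec (Fin.cons 0 s : Fin (n+1) → ℝ) (Pi.single 0 1), by
    rw [Matrix.det_of_isLowerTriangular]
    · apply Finset.prod_eq_one
      intro i _
      refine Fin.cases ?_ (fun i => ?_) i <;> simp [Matrix.vecMulVec_apply]
    · intro i j hij
      have hij' : i < j := hij
      have hj : j ≠ 0 := (Fin.zero_le i).trans_lt hij' |>.ne'
      simp [Matrix.vecMulVec_apply, Matrix.one_apply_ne hij'.ne, hj]⟩

lemma hSL_coe {n : ℕ} (s : Fin n → ℝ) : ((hSL s : SLd (n+1)) : Matrix (Fin (n+1)) (Fin (n+1)) ℝ) =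
  1 + Matrix.vecMulVec (Fin.cons 0 s : Fin (n+1) → ℝ) (Pi.single 0 1) := rfl

lemma aSL_coe (n k : ℕ) : ((aSL n k : SLd (n+1)) : Matrix (Fin (n+1)) (Fin (n+1)) ℝ) =
  Matrix.diagonal fun i => alp n i ^ k := rfl

lemma hSL_mulVec {n : ℕ} (s : Fin n → ℝ) (w : Fin (n+1) → ℝ) :
    ((hSL s : SLd (n+1)) : Matrix (Fin (n+1)) (Fin (n+1)) ℝ).mulVec w =
      Fin.cons (w 0) (fun i => w i.succ + s i * w 0) := by
  rw [hSL_coe, Matrix.add_mulVec, Matrix.one_mulVec]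
  ext i
  refine Fin.cases ?_ (fun i => ?_) i <;>
    simp [Matrix.vecMulVec_mulVec, mul_comm]

lemma hSL_cont {n : ℕ} : Continuous (hSL : (Fin n → ℝ) → SLd (n+1)) := by
  rw [(isEmb (n+1)).isEmbedding.continuous_iff]
  apply continuous_matrix
  intro i j
  simp only [Function.comp, hSL_coe, Matrix.add_apply, Matrix.vecMulVec_apply]
  refine Fin.cases ?_ (fun i => ?_) i
  · simp only [Fin.cons_zero]; fun_prop
  · simp only [Fin.cons_succ]; fun_prop

def Bad {n : ℕ} (δ : ℝ) (k : ℕ) : Set (SLd (n+1)) :=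
  {g | ∃ m : Fin (n+1) → ℤ, m ≠ 0 ∧
    ∀ i, |((aSL n k * g : SLd (n+1)) : Matrix (Fin (n+1)) (Fin (n+1)) ℝ).mulVec (zv m) i| < δ}

lemma Bad_open {n : ℕ} (δ : ℝ) (k : ℕ) : IsOpen (Bad (n := n) δ k) := by
  have : Bad (n := n) δ k = ⋃ m : Fin (n+1) → ℤ, ⋃ _ : m ≠ 0, ⋂ i,
      {g | |((aSL n k * g : SLd (n+1)) : Matrix (Fin (n+1)) (Fin (n+1)) ℝ).mulVec (zv m) i| < δ} := by
    ext g
    simp [Bad]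
  rw [this]
  refine isOpen_iUnion fun m => isOpen_iUnion fun _ => isOpen_iInter_of_finite fun i => ?_
  have h : Continuous fun g : SLd (n+1) =>
      ((aSL n k * g : SLd (n+1)) : Matrix (Fin (n+1)) (Fin (n+1)) ℝ).mulVec (zv m) i := by
    have h1 : Continuous fun g : SLd (n+1) => ((aSL n k * g : SLd (n+1)) : Matrix (Fin (n+1)) (Fin (n+1)) ℝ) :=
      (cont_coe _).comp (continuous_const.mul continuous_id)
    exact (continuous_apply i).comp (h1.matrix_mulVec continuous_const)
  exact isOpen_lt h.abs continuous_const

/-- uniform lower bound on compact sets -/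
lemma compact_lower {d : ℕ} (C : Set (SLd d)) (hC : IsCompact C) : ∃ c : ℝ, 0 < c ∧ ∀ g ∈ C,
    ∀ m : Fin d → ℤ, m ≠ 0 → ∃ i, c ≤ |(g : Matrix (Fin d) (Fin d) ℝ).mulVec (zv m) i| := by
  have hcont : Continuous fun g : SLd d => ∑ i, ∑ j, |((g⁻¹ : SLd d) : Matrix (Fin d) (Fin d) ℝ) i j| := by
    refine continuous_finsetSum _ fun i _ => continuous_finsetSum _ fun j _ => ?_
    exact ((cont_entry i j).comp continuous_inv).abs
  obtain ⟨R, hR⟩ := hC.exists_bound_of_continuousOn hcont.continuousOn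
  have hRp : 0 < |R| + 1 := by positivity
  refine ⟨1 / (|R| + 1), by positivity, fun g hg m hm => ?_⟩
  by_contra hcon
  push Not at hcon
  obtain ⟨j, hj⟩ := Function.ne_iff.1 hm
  have hj1 : (1:ℝ) ≤ |(m j : ℝ)| := by
    have : (1:ℤ) ≤ |m j| := Int.one_le_abs hj
    exact_mod_cast this
  have hm : zv m = ((g⁻¹ : SLd d) : Matrix (Fin d) (Fin d) ℝ).mulVec ((g : Matrix (Fin d) (Fin d) ℝ).mulVec (zv m)) := by
    rw [Matrix.mulVec_mulVec, ← Matrix.SpecialLinearGroup.coe_mul, inv_mul_cancel]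
    simp
  have h1 : |(m j : ℝ)| ≤ (∑ i, |((g⁻¹ : SLd d) : Matrix (Fin d) (Fin d) ℝ) j i|) * (1 / (|R| + 1)) := by
    have : (m j : ℝ) = ∑ i, ((g⁻¹ : SLd d) : Matrix (Fin d) (Fin d) ℝ) j i *
        ((g : Matrix (Fin d) (Fin d) ℝ).mulVec (zv m)) i := congrFun hm j
    rw [this, Finset.sum_mul]
    refine (Finset.abs_sum_le_sum_abs _ _).trans (Finset.sum_le_sum fun i _ => ?_)
    rw [abs_mul]
    exact mul_le_mul_of_nonneg_left (hcon i).le (abs_nonneg _)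
  have h2 : (∑ i, |((g⁻¹ : SLd d) : Matrix (Fin d) (Fin d) ℝ) j i|) ≤ |R| := by
    refine le_trans ?_ ((le_abs_self _).trans ((hR g hg).trans (le_abs_self R)))
    exact Finset.single_le_sum (f := fun j => ∑ i, |((g⁻¹ : SLd d) : Matrix (Fin d) (Fin d) ℝ) j i|)
      (fun i _ => Finset.sum_nonneg fun _ _ => abs_nonneg _) (Finset.mem_univ j)
  have h3 : |R| * (1 / (|R| + 1)) < 1 := by
    rw [mul_one_div, div_lt_one hRp]; linarith
  have h4 := mul_le_mul_of_nonneg_right h2 (by positivity : 0 ≤ 1 / (|R| + 1))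
  linarith

theorem S1meas {n : ℕ} (μ : Measure (SLd (n+1))) [μ.IsHaarMeasure] (C : Set (SLd (n+1))) (hC : IsCompact C)
    (ε : ENNReal) (hε : ε ≠ 0) : ∃ δ : ℝ, 0 < δ ∧ ∀ k, μ (C ∩ Bad δ k) ≤ ε := by
  set Q : Set (Fin n → ℝ) := Set.pi Set.univ fun _ => Set.Icc (0:ℝ) 1 with hQ
  have hQc : IsCompact Q := isCompact_univ_pi fun _ => isCompact_Icc
  have hQv : volume Q = 1 := by rw [hQ, volume_pi_pi]; simp
  set C2 : Set (SLd (n+1)) := (fun p : (Fin n → ℝ) × SLd (n+1) => (hSL p.1)⁻¹ * p.2) '' (Q ×ˢ C) with hC2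
  have hC2c : IsCompact C2 :=
    (hQc.prod hC).image ((hSL_cont.comp continuous_fst).inv.mul continuous_snd)
  obtain ⟨c, hc, hcl⟩ := compact_lower C2 hC2c
  have hV : μ C2 ≠ ⊤ := hC2c.measure_lt_top.ne
  have hlim : Filter.Tendsto (fun δ : ℝ => μ C2 * ENNReal.ofReal ((88 * δ / c) ^ (n+1))) (nhdsWithin 0 (Set.Ioi 0)) (nhds 0) := by
    have h1 : Continuous fun δ : ℝ => (88 * δ / c) ^ (n+1) := by fun_prop
    have h2 := ENNReal.Tendsto.const_mul (a := μ C2) ((ENNReal.continuous_ofReal.comp h1).tendsto 0) (Or.inr hV)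
    simp at h2
    exact h2.mono_left nhdsWithin_le_nhds
  have hev := hlim.eventually (gt_mem_nhds (pos_iff_ne_zero.2 hε))
  have hev2 : ∀ᶠ δ : ℝ in nhdsWithin 0 (Set.Ioi 0), δ < c / 2 :=
    nhdsWithin_le_nhds (gt_mem_nhds (by positivity))
  obtain ⟨δ, hδ1, hδ2, hδ0⟩ := (hev.and (hev2.and self_mem_nhdsWithin)).exists
  have hδ0 : 0 < δ := hδ0
  refine ⟨δ, hδ0, fun k => le_trans ?_ hδ1.le⟩
  set S := C ∩ Bad δ k with hS
  have hSm : MeasurableSet S := hC.isClosed.measurableSet.inter (Bad_open δ k).measurableSet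
  set ν := (volume : Measure (Fin n → ℝ)).restrict Q with hν
  set Z : Set ((Fin n → ℝ) × SLd (n+1)) := (fun p => hSL p.1 * p.2) ⁻¹' S with hZ
  have hZm : MeasurableSet Z := by
    have : Continuous fun p : (Fin n → ℝ) × SLd (n+1) => hSL p.1 * p.2 :=
      (hSL_cont.comp continuous_fst).mul continuous_snd
    exact this.measurable hSm
  have e1 : (ν.prod μ) Z = μ S := by
    rw [Measure.prod_apply hZm]
    have : ∀ s : Fin n → ℝ, μ (Prod.mk s ⁻¹' Z) = μ S := by
      intro s
      exact measure_preimage_mul μ (hSL s) S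
    simp only [this, lintegral_const, hν, Measure.restrict_apply_univ, hQv, mul_one]
  have e2 : (ν.prod μ) Z = ∫⁻ g, ν ((fun s => (s, g)) ⁻¹' Z) ∂μ := Measure.prod_apply_symm hZm
  have hQmeas : MeasurableSet Q := hQc.isClosed.measurableSet
  have hb : ∀ g, ν ((fun s => (s, g)) ⁻¹' Z) ≤
      C2.indicator (fun _ => ENNReal.ofReal ((88 * δ / c) ^ (n+1))) g := by
    intro g
    rw [hν, Measure.restrict_apply' hQmeas]
    by_cases hg : g ∈ C2
    · rw [Set.indicator_of_mem hg]
      refine le_trans (measure_mono ?_) (S1core n c δ hc hδ0 (by linarith)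
        (fun i => alp n i.succ ^ k) (fun i => one_le_pow₀ (by
          simp only [alp, Fin.cons_succ]
          have : (0:ℝ) ≤ (i : ℝ) := by positivity
          linarith)) g (hcl g hg))
      rintro s ⟨⟨-, m, hm, hms⟩, hsQ⟩
      refine ⟨fun i => Set.mem_univ_pi.1 hsQ i, m, hm, ?_⟩
      have key : ((aSL n k * (hSL s * g) : SLd (n+1)) : Matrix (Fin (n+1)) (Fin (n+1)) ℝ).mulVec (zv m) =
          (Matrix.diagonal fun i => alp n i ^ k).mulVec (Fin.cons ((g : Matrix (Fin (n+1)) (Fin (n+1)) ℝ).mulVec (zv m) 0)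
            (fun i => (g : Matrix (Fin (n+1)) (Fin (n+1)) ℝ).mulVec (zv m) i.succ + s i * (g : Matrix (Fin (n+1)) (Fin (n+1)) ℝ).mulVec (zv m) 0)) := by
        rw [Matrix.SpecialLinearGroup.coe_mul, Matrix.SpecialLinearGroup.coe_mul, ← Matrix.mulVec_mulVec,
          ← Matrix.mulVec_mulVec, hSL_mulVec, aSL_coe]
      simp only [key, Matrix.mulVec_diagonal] at hms
      constructor
      · have h0 := hms 0
        rw [Fin.cons_zero, abs_mul, abs_of_pos (pow_pos (alp_pos n 0) k)] at h0
        have hp : alp n 0 ^ k * ∏ i : Fin n, alp n i.succ ^ k = 1 := by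
          rw [← Fin.prod_univ_succ (fun i => alp n i ^ k), Finset.prod_pow, alp_prod, one_pow]
        have hp0 : 0 < ∏ i : Fin n, alp n i.succ ^ k := Finset.prod_pos fun i _ => pow_pos (alp_pos n _) k
        calc _ = (alp n 0 ^ k * |(g : Matrix (Fin (n+1)) (Fin (n+1)) ℝ).mulVec (zv m) 0|) * ∏ i : Fin n, alp n i.succ ^ k := by
              rw [mul_right_comm, hp, one_mul]
          _ < _ := mul_lt_mul_of_pos_right h0 hp0
      · intro i
        have h0 := hms i.succ
        rw [Fin.cons_succ, abs_mul, abs_of_pos (pow_pos (alp_pos n _) k)] at h0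
        rw [lt_div_iff₀ (pow_pos (alp_pos n _) k), mul_comm]
        exact h0
    · rw [Set.indicator_of_notMem hg]
      have : (fun s => (s, g)) ⁻¹' Z ∩ Q = ∅ := by
        rw [Set.eq_empty_iff_forall_notMem]
        rintro s ⟨hs, hsQ⟩
        apply hg
        exact ⟨(s, hSL s * g), ⟨hsQ, hs.1⟩, by simp⟩
      rw [this, measure_empty]
  rw [← e1, e2]
  refine (lintegral_mono hb).trans ?_
  rw [lintegral_indicator_const hC2c.isClosed.measurableSet, mul_comm]

end FLproof

namespace FLproof
open MeasureTheory Filter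
open scoped Pointwise

/-- lower unipotent -/
def Uni {n : ℕ} (u : SLd n) : Prop :=
  LowTri (u : Matrix (Fin n) (Fin n) ℝ) ∧ ∀ i, (u : Matrix (Fin n) (Fin n) ℝ) i i = 1

lemma aSL_inv (n k : ℕ) : (((aSL n k)⁻¹ : SLd (n+1)) : Matrix (Fin (n+1)) (Fin (n+1)) ℝ) =
    Matrix.diagonal fun i => (alp n i ^ k)⁻¹ := by
  have h1 : (aSL n k : Matrix (Fin (n+1)) (Fin (n+1)) ℝ) * Matrix.diagonal (fun i => (alp n i ^ k)⁻¹) = 1 := by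
    rw [aSL_coe, Matrix.diagonal_mul_diagonal, ← Matrix.diagonal_one]
    congr 1
    ext i
    exact mul_inv_cancel₀ (pow_pos (alp_pos n i) k).ne'
  have h2 : (((aSL n k)⁻¹ : SLd (n+1)) : Matrix (Fin (n+1)) (Fin (n+1)) ℝ) * (aSL n k) = 1 := by
    rw [← Matrix.SpecialLinearGroup.coe_mul, inv_mul_cancel]; simp
  calc _ = (((aSL n k)⁻¹ : SLd (n+1)) : Matrix (Fin (n+1)) (Fin (n+1)) ℝ) *
        ((aSL n k : Matrix (Fin (n+1)) (Fin (n+1)) ℝ) * Matrix.diagonal (fun i => (alp n i ^ k)⁻¹)) := by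
        rw [h1, Matrix.mul_one]
    _ = _ := by rw [← Matrix.mul_assoc, h2, Matrix.one_mul]

lemma conj_tendsto {n : ℕ} (u : SLd (n+1)) (hu : Uni u) :
    Tendsto (fun k => (aSL n k)⁻¹ * u * aSL n k) atTop (nhds 1) := by
  rw [(isEmb (n+1)).isEmbedding.tendsto_nhds_iff]
  refine tendsto_pi_nhds.2 fun i => tendsto_pi_nhds.2 fun j => ?_
  have key : ∀ k, (((aSL n k)⁻¹ * u * aSL n k : SLd (n+1)) : Matrix (Fin (n+1)) (Fin (n+1)) ℝ) i j =
      (u : Matrix (Fin (n+1)) (Fin (n+1)) ℝ) i j * (alp n j / alp n i) ^ k := by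
    intro k
    rw [Matrix.SpecialLinearGroup.coe_mul, Matrix.SpecialLinearGroup.coe_mul, aSL_inv, aSL_coe,
      Matrix.mul_diagonal, Matrix.diagonal_mul, div_pow]
    have := (pow_pos (alp_pos n i) k).ne'
    field_simp
  have : (fun k => (((aSL n k)⁻¹ * u * aSL n k : SLd (n+1)) : Matrix (Fin (n+1)) (Fin (n+1)) ℝ) i j) =
    fun k => (u : Matrix (Fin (n+1)) (Fin (n+1)) ℝ) i j * (alp n j / alp n i) ^ k := funext key
  change Tendsto (fun k => (((aSL n k)⁻¹ * u * aSL n k : SLd (n+1)) : Matrix (Fin (n+1)) (Fin (n+1)) ℝ) i j) _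
    (nhds (((1 : SLd (n+1)) : Matrix (Fin (n+1)) (Fin (n+1)) ℝ) i j))
  rw [this, Matrix.SpecialLinearGroup.coe_one]
  rcases lt_trichotomy i j with h | h | h
  · simp [hu.1 i j h, Matrix.one_apply_ne h.ne]
  · subst h
    simp [hu.2, div_self (alp_pos n i).ne']
  · rw [Matrix.one_apply_ne h.ne']
    have h1 : Tendsto (fun k => (alp n j / alp n i) ^ k) atTop (nhds 0) :=
      tendsto_pow_atTop_nhds_zero_of_lt_one (div_pos (alp_pos n j) (alp_pos n i)).le
        ((div_lt_one (alp_pos n i)).2 (alp_lt n j i h))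
    simpa using h1.const_mul _

lemma S2 {n : ℕ} (μ : Measure (SLd (n+1))) [μ.IsHaarMeasure] (C : Set (SLd (n+1))) (hC : IsCompact C)
    (u : SLd (n+1)) (hu : Uni u) :
    Tendsto (fun k => μ (C \ {g | (aSL n k)⁻¹ * u * aSL n k * g ∈ C})) atTop (nhds 0) := by
  have h := (tendsto_measure_smul_sdiff_isCompact_isClosed (μ := μ) hC hC.isClosed).comp (conj_tendsto u hu)
  refine h.congr fun k => ?_
  simp only [Function.comp]
  set x := (aSL n k)⁻¹ * u * aSL n k
  rw [← measure_preimage_mul μ x (x • C \ C)]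
  congr 1
  ext g
  simp only [Set.mem_preimage, Set.mem_sdiff, Set.mem_ofPred_eq]
  have : x * g ∈ x • C ↔ g ∈ C := by
    rw [← smul_eq_mul]; exact Set.smul_mem_smul_set_iff
  rw [this]

/-- right multiplication by an integer matrix -/
noncomputable def zSL {d : ℕ} (γ : Matrix (Fin d) (Fin d) ℤ) (h : γ.det = 1) : SLd d :=
  ⟨zm γ, by rw [zm_det, h]; simp⟩

theorem exists_full {n : ℕ} (μ : Measure (SLd (n+1))) [μ.IsHaarMeasure] (E : Set (SLd (n+1)))
    (hE : IsClosed E) (hA : ∀ k, ∀ g ∈ E, aSL n k * g ∈ E)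
    (hΓ : ∀ γ (h : γ.det = 1), ∀ g ∈ E, g * zSL γ h ∈ E) (hμ : μ E ≠ 0) :
    ∃ gs : SLd (n+1), ∀ u, Uni u → u * gs ∈ E := by
  -- compact piece
  obtain ⟨C, hCE, hC, hC0⟩ : ∃ C ⊆ E, IsCompact C ∧ μ C ≠ 0 := by
    by_contra hcon
    push Not at hcon
    apply hμ
    have : E = ⋃ j, (E ∩ compactCovering (SLd (n+1)) j) := by
      rw [← Set.inter_iUnion, iUnion_compactCovering, Set.inter_univ]
    rw [this]
    refine measure_iUnion_null fun j => hcon _ Set.inter_subset_left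
      ((isCompact_compactCovering _ j).inter_left hE)
  have hCt : μ C ≠ ⊤ := hC.measure_lt_top.ne
  obtain ⟨δ, hδ, hbad⟩ := S1meas μ C hC (μ C / 2) (by simpa using hC0)
  let Us : Type := {u : SLd (n+1) // Uni u}
  have hsec : SecondCountableTopology Us :=
    TopologicalSpace.Subtype.secondCountableTopology {u : SLd (n+1) | Uni u}
  have hne : Nonempty Us := ⟨⟨1, by
    refine ⟨fun i j h => ?_, fun i => ?_⟩
    · rw [Matrix.SpecialLinearGroup.coe_one, Matrix.one_apply_ne h.ne]
    · rw [Matrix.SpecialLinearGroup.coe_one, Matrix.one_apply_eq]⟩⟩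
  let us : ℕ → Us := TopologicalSpace.denseSeq Us
  have hstep : ∀ N : ℕ, ∃ k, ∃ g ∈ C, g ∉ Bad δ k ∧
      ∀ j < N, (aSL n k)⁻¹ * (us j).1 * aSL n k * g ∈ C := by
    intro N
    have hsum : Tendsto (fun k => ∑ j ∈ Finset.range N,
        μ (C \ {g | (aSL n k)⁻¹ * (us j).1 * aSL n k * g ∈ C})) atTop (nhds 0) := by
      have := tendsto_finsetSum (Finset.range N) fun j _ => S2 μ C hC (us j).1 (us j).2
      simpa using this
    obtain ⟨k, hk⟩ := (hsum.eventually (gt_mem_nhds (ENNReal.half_pos hC0))).exists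
    refine ⟨k, ?_⟩
    by_contra hcon
    push Not at hcon
    have hsub : C ⊆ (C ∩ Bad δ k) ∪ ⋃ j ∈ Finset.range N,
        (C \ {g | (aSL n k)⁻¹ * (us j).1 * aSL n k * g ∈ C}) := by
      intro g hg
      by_cases hb : g ∈ Bad δ k
      · exact Or.inl ⟨hg, hb⟩
      · right
        obtain ⟨j, hj, hjC⟩ := hcon g hg hb
        exact Set.mem_biUnion (Finset.mem_coe.2 (Finset.mem_range.2 hj)) ⟨hg, hjC⟩
    have h1 : μ C < μ C := calc
      μ C ≤ _ := measure_mono hsub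
      _ ≤ _ := measure_union_le _ _
      _ ≤ μ C / 2 + ∑ j ∈ Finset.range N, μ (C \ {g | (aSL n k)⁻¹ * (us j).1 * aSL n k * g ∈ C}) :=
          add_le_add (hbad k) (measure_biUnion_finset_le _ _)
      _ < μ C / 2 + μ C / 2 :=
          ENNReal.add_lt_add_left (ENNReal.div_ne_top hCt (by norm_num)) hk
      _ = μ C := ENNReal.add_halves _
    exact lt_irrefl _ h1
  choose k g hgC hgB hgu using hstep
  set G : ℕ → SLd (n+1) := fun N => aSL n (k N) * g N with hG
  have hGE : ∀ N, ∀ j < N, (us j).1 * G N ∈ E := by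
    intro N j hj
    have h1 := hA (k N) _ (hCE (hgu N j hj))
    have : aSL n (k N) * ((aSL n (k N))⁻¹ * (us j).1 * aSL n (k N) * g N) = (us j).1 * G N := by
      simp only [hG, mul_assoc, mul_inv_cancel_left]
    rwa [this] at h1
  obtain ⟨γ, φ, gs, hφ, hγ, hlim⟩ := mahler (Nat.succ_pos n) δ hδ (fun N => (G N : Matrix (Fin (n+1)) (Fin (n+1)) ℝ))
    (fun N => (G N).2) (by
      intro N m hm
      by_contra hcon
      push Not at hcon
      exact hgB N ⟨m, hm, hcon⟩)
  have hdet : gs.det = 1 := by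
    have hc : Continuous fun X : Matrix (Fin (n+1)) (Fin (n+1)) ℝ => X.det := Continuous.matrix_det continuous_id
    have h1 := (hc.tendsto gs).comp hlim
    refine tendsto_nhds_unique h1 ?_
    refine tendsto_const_nhds.congr fun N => ?_
    simp only [Function.comp, Matrix.det_mul, zm_det, hγ, (G (φ N)).2]
    simp
  set gS : SLd (n+1) := ⟨gs, hdet⟩ with hgS
  have hlim2 : Tendsto (fun N => G (φ N) * zSL (γ N) (hγ N)) atTop (nhds gS) := by
    rw [(isEmb (n+1)).isEmbedding.tendsto_nhds_iff]
    exact hlim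
  have hjs : ∀ j, (us j).1 * gS ∈ E := by
    intro j
    refine hE.mem_of_tendsto (hlim2.const_mul (us j).1) ?_
    filter_upwards [eventually_gt_atTop j] with N hN
    rw [← mul_assoc]
    exact hΓ _ _ _ (hGE (φ N) j (hN.trans_le (hφ.id_le N)))
  refine ⟨gS, fun u hu => ?_⟩
  have hcl : IsClosed {v : Us | v.1 * gS ∈ E} :=
    hE.preimage (continuous_subtype_val.mul continuous_const)
  have hd : Dense (Set.range us) := TopologicalSpace.denseRange_denseSeq Us
  have : closure (Set.range us) ⊆ {v : Us | v.1 * gS ∈ E} :=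
    hcl.closure_subset_iff.2 (by rintro _ ⟨j, rfl⟩; exact hjs j)
  exact this (hd.closure_eq ▸ Set.mem_univ (⟨u, hu⟩ : Us))

theorem null_avoid {n : ℕ} (μ : Measure (SLd (n+1))) [μ.IsHaarMeasure] (g0 : Matrix (Fin (n+1)) (Fin (n+1)) ℝ)
    (hg0 : g0.det = 1) (W : Set (Matrix (Fin (n+1)) (Fin (n+1)) ℝ)) (hW : IsOpen W) (h0 : g0 ∈ W) :
    μ {g : SLd (n+1) | ∀ a : Fin (n+1) → ℝ, ∏ i, a i = 1 → ∀ γ : Matrix (Fin (n+1)) (Fin (n+1)) ℤ, γ.det = 1 →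
      Matrix.diagonal a * (g : Matrix (Fin (n+1)) (Fin (n+1)) ℝ) * zm γ ∉ W} = 0 := by
  set E := {g : SLd (n+1) | ∀ a : Fin (n+1) → ℝ, ∏ i, a i = 1 → ∀ γ : Matrix (Fin (n+1)) (Fin (n+1)) ℤ, γ.det = 1 →
      Matrix.diagonal a * (g : Matrix (Fin (n+1)) (Fin (n+1)) ℝ) * zm γ ∉ W} with hE
  by_contra hμ
  have hEc : IsClosed E := by
    simp only [hE, Set.ofPred_forall]
    refine isClosed_iInter fun a => isClosed_iInter fun _ => isClosed_iInter fun γ => isClosed_iInter fun _ => ?_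
    have hc : Continuous fun g : SLd (n+1) => Matrix.diagonal a * (g : Matrix (Fin (n+1)) (Fin (n+1)) ℝ) * zm γ :=
      (continuous_const.matrix_mul (cont_coe _)).matrix_mul continuous_const
    exact (hW.isClosed_compl).preimage hc
  obtain ⟨gs, hgs⟩ := exists_full μ E hEc
    (by
      intro k g hg a ha γ hγ
      have := hg (fun i => a i * alp n i ^ k)
        (by rw [Finset.prod_mul_distrib, ha, Finset.prod_pow, alp_prod]; simp) γ hγ
      rw [Matrix.SpecialLinearGroup.coe_mul, aSL_coe, ← Matrix.mul_assoc, Matrix.diagonal_mul_diagonal]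
      exact this)
    (by
      intro γ' hγ' g hg a ha γ hγ
      have := hg a ha (γ' * γ) (by rw [Matrix.det_mul, hγ, hγ', one_mul])
      rw [zm_mul] at this
      rw [Matrix.SpecialLinearGroup.coe_mul, ← Matrix.mul_assoc, Matrix.mul_assoc _ _ (zm γ)]
      exact this) hμ
  obtain ⟨p, hp, hpd, γ, hγ, hpW⟩ := S3 (d := n+1) (Nat.succ_pos n) (gs : Matrix (Fin (n+1)) (Fin (n+1)) ℝ) g0 gs.2 hg0 W hW h0
  have hprod : ∏ i, p i i = 1 := by
    rw [← hpd, Matrix.det_of_isLowerTriangular]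
    intro i j hij
    exact hp i j hij
  have hpi : ∀ i, p i i ≠ 0 := by
    intro i hi
    rw [Finset.prod_eq_zero (f := fun i => p i i) (Finset.mem_univ i) hi] at hprod
    exact zero_ne_one hprod
  set u : Matrix (Fin (n+1)) (Fin (n+1)) ℝ := Matrix.diagonal (fun i => (p i i)⁻¹) * p with hu
  have hud : u.det = 1 := by
    rw [hu, Matrix.det_mul, hpd, Matrix.det_diagonal, Finset.prod_inv_distrib, hprod]; simp
  have huU : Uni (⟨u, hud⟩ : SLd (n+1)) := by
    refine ⟨fun i j hij => ?_, fun i => ?_⟩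
    · change u i j = 0
      rw [hu, Matrix.diagonal_mul, hp i j hij, mul_zero]
    · change u i i = 1
      rw [hu, Matrix.diagonal_mul, inv_mul_cancel₀ (hpi i)]
  have := hgs _ huU (fun i => p i i) hprod γ hγ
  apply this
  have e : Matrix.diagonal (fun i => p i i) * u = p := by
    rw [hu, ← Matrix.mul_assoc, Matrix.diagonal_mul_diagonal]
    simp [hpi]
  change Matrix.diagonal (fun i => p i i) * (u * (gs : Matrix (Fin (n+1)) (Fin (n+1)) ℝ)) * zm γ ∈ W
  rw [← Matrix.mul_assoc, e]
  exact hpW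

theorem main (d : ℕ) (hd : 3 ≤ d) (μ : Measure (SLd d)) [μ.IsHaarMeasure] :
    μ {g : SLd d | ¬ IsGFL (latticeOf g)} = 0 := by
  obtain ⟨n, rfl⟩ : ∃ n, d = n + 1 := ⟨d - 1, by omega⟩
  obtain ⟨g0, hg0, hgood⟩ := exists_good (n+1) hd
  obtain ⟨V, hV⟩ := (nhds g0).exists_antitone_basis
  have hVn : ∀ j, V j ∈ nhds g0 := fun j => hV.1.mem_of_mem trivial
  refine measure_mono_null ?_ (measure_iUnion_null fun j : ℕ =>
    null_avoid μ g0 hg0 (interior (V j)) isOpen_interior (mem_interior_iff_mem_nhds.2 (hVn j)))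
  intro g hg
  by_contra hcon
  apply hg
  simp only [Set.mem_iUnion, Set.mem_ofPred_eq] at hcon
  push Not at hcon
  choose a ha γ hγ hmem using hcon
  exact inherit g0 hgood g a (fun k => by rw [ha]; simp) γ hγ
    (hV.tendsto fun j => interior_subset (hmem j))

end FLproof

/-- For `d ≥ 3`, Haar-almost every `g ∈ SL_d(ℝ)` gives a GFL lattice `gℤ^d`. -/
theorem stmt_16 (d : ℕ) (hd : 3 ≤ d) :
    ∀ μ : MeasureTheory.Measure (SLd d), μ.IsHaarMeasure →
      μ {g : SLd d | ¬ IsGFL (latticeOf g)} = 0 := by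
  intro μ hμ
  exact FLproof.main d hd μ


end
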